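/- arXiv:2106.10128 — 6 statements merged into one kernel-verified Lean document; each statement's English description precedes it below -/
import Mathlib

section
/- Let X = Σ_i ξ_i D^i + Σ_β (D^β ε) ∂/∂y^β, where ξ_1,…,ξ_n and ε are admissible functions on J^∞(ℝ^n,ℝ). Suppose there are integers a > 1 and b ≥ 0 with: ∂ε/∂y^α = 0 for all |α| > a, ∂ξ_i/∂y^α = 0 for all i and all |α| > b, and ∂ε/∂y^ᾱ ≠ 0 for some ᾱ with |ᾱ| = a. Let k > b and let Φ = Σ_{|γ|=k} y^γ Ψ_γ + ρ, where each Ψ_γ and ρ are admissible functions depending only on x and coordinates y^β with |β| < k. Then for every ℓ ≥ 1: X^ℓ Φ = Σ_{|γ|=k} Σ_{|β_1|=a} ⋯ Σ_{|β_ℓ|=a} y^{γ+β_1+⋯+β_ℓ} (∂ε/∂y^{β_1}) ⋯ (∂ε/∂y^{β_ℓ}) Ψ_γ + R, where R is admissible and ∂R/∂y^β = 0 for every β with |β| ≥ ℓa + k. -/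
open scoped BigOperators

/-- Multiindices in `n` variables. -/
abbrev MI (n : ℕ) := Fin n → ℕ

/-- The infinite jet space `J^∞(ℝ^n, ℝ)`: coordinates `x_i` and `y^α`. -/
abbrev Jet (n : ℕ) := (Fin n → ℝ) × (MI n → ℝ)

/-- Degree `|α|` of a multiindex. -/
def mdeg {n : ℕ} (α : MI n) : ℕ := ∑ j, α j

/-- Partial derivative with respect to the coordinate `x_i`. -/
noncomputable def pdX {n : ℕ} (i : Fin n) (F : Jet n → ℝ) : Jet n → ℝ :=
  fun p => deriv (fun t => F (Function.update p.1 i t, p.2)) (p.1 i)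

/-- Partial derivative with respect to the coordinate `y^α`. -/
noncomputable def pdY {n : ℕ} (α : MI n) (F : Jet n → ℝ) : Jet n → ℝ :=
  fun p => deriv (fun t => F (p.1, Function.update p.2 α t)) (p.2 α)

/-- A function on `J^∞(ℝ^n,ℝ)` is admissible if it is a `C^∞` function of
finitely many of the coordinates. -/
def Admissible {n : ℕ} (F : Jet n → ℝ) : Prop :=
  ∃ (S : Finset (MI n)) (g : ((Fin n → ℝ) × (↥S → ℝ)) → ℝ),
    ContDiff ℝ (⊤ : ℕ∞) g ∧ ∀ p : Jet n, F p = g (p.1, fun a => p.2 a.1)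

/-- The total derivative `D^i`. -/
noncomputable def totD {n : ℕ} (i : Fin n) (F : Jet n → ℝ) : Jet n → ℝ :=
  fun p => pdX i F p + ∑ᶠ α : MI n, p.2 (α + Pi.single i 1) * pdY α F p

/-- Iterated total derivative `D^α = (D^1)^{α_1} ⋯ (D^n)^{α_n}`. -/
noncomputable def totDpow {n : ℕ} (α : MI n) (F : Jet n → ℝ) : Jet n → ℝ :=
  (List.finRange n).foldr (fun i G => (totD i)^[α i] G) F


/-- `F` depends only on `x` and the coordinates `y^β` with `|β| < k`. -/
def DependsOnLT {n : ℕ} (k : ℕ) (F : Jet n → ℝ) : Prop :=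
  ∀ p q : Jet n, p.1 = q.1 → (∀ β : MI n, mdeg β < k → p.2 β = q.2 β) → F p = F q

/-- The action of the field `X = Σ_i ξ_i D^i + Σ_β (D^β ε) ∂/∂y^β` on functions. -/
noncomputable def XAct {n : ℕ} (ξ : Fin n → Jet n → ℝ) (ε : Jet n → ℝ)
    (F : Jet n → ℝ) : Jet n → ℝ :=
  fun p => (∑ i, ξ i p * totD i F p) + ∑ᶠ β : MI n, totDpow β ε p * pdY β F p

namespace Jet

open Function Finset

variable {n : ℕ} {F G : Jet n → ℝ} {K N : ℕ}

theorem admissible_exists_superset (hF : Admissible F) (T : Finset (MI n)) :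
    ∃ S : Finset (MI n), T ⊆ S ∧ ∃ g : ((Fin n → ℝ) × (↥S → ℝ)) → ℝ,
      ContDiff ℝ (⊤ : ℕ∞) g ∧ ∀ p : Jet n, F p = g (p.1, fun a => p.2 a.1) := by
  classical
  obtain ⟨S, g, hg, h⟩ := hF
  refine ⟨T ∪ S, subset_union_left,
    fun z => g (z.1, fun a => z.2 ⟨a.1, mem_union_right T a.2⟩), ?_, h⟩
  exact hg.comp (by fun_prop)

theorem admissible_const (c : ℝ) : Admissible (fun _ : Jet n => c) :=
  ⟨∅, fun _ => c, contDiff_const, fun _ => rfl⟩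

theorem admissible_coord (γ : MI n) : Admissible (fun p : Jet n => p.2 γ) :=
  ⟨{γ}, fun z => z.2 ⟨γ, mem_singleton_self γ⟩, by fun_prop, fun _ => rfl⟩

theorem admissible_add (hF : Admissible F) (hG : Admissible G) : Admissible (F + G) := by
  obtain ⟨S, g, hg, h⟩ := hF
  obtain ⟨T, hST, g', hg', h'⟩ := admissible_exists_superset hG S
  refine ⟨T, fun z => g (z.1, fun a => z.2 ⟨a.1, hST a.2⟩) + g' z, ?_, fun p => ?_⟩
  · exact (hg.comp (by fun_prop)).add hg'
  · simp [h, h']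

theorem admissible_mul (hF : Admissible F) (hG : Admissible G) : Admissible (F * G) := by
  obtain ⟨S, g, hg, h⟩ := hF
  obtain ⟨T, hST, g', hg', h'⟩ := admissible_exists_superset hG S
  refine ⟨T, fun z => g (z.1, fun a => z.2 ⟨a.1, hST a.2⟩) * g' z, ?_, fun p => ?_⟩
  · exact (hg.comp (by fun_prop)).mul hg'
  · simp [h, h']

/-- `F` is a smooth function of `x` and of finitely many `y^β` with `|β| < K`. -/
def OrdLT (K : ℕ) (F : Jet n → ℝ) : Prop := Admissible F ∧ DependsOnLT K F

theorem OrdLT.mono (hF : OrdLT K F) (h : K ≤ N) : OrdLT N F :=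
  ⟨hF.1, fun p q h1 h2 => hF.2 p q h1 fun β hβ => h2 β (hβ.trans_le h)⟩

theorem OrdLT.add (hF : OrdLT K F) (hG : OrdLT K G) : OrdLT K (F + G) :=
  ⟨admissible_add hF.1 hG.1, fun p q h1 h2 => by
    simp [hF.2 p q h1 h2, hG.2 p q h1 h2]⟩

theorem OrdLT.mul (hF : OrdLT K F) (hG : OrdLT K G) : OrdLT K (F * G) :=
  ⟨admissible_mul hF.1 hG.1, fun p q h1 h2 => by
    simp [hF.2 p q h1 h2, hG.2 p q h1 h2]⟩

theorem ordLT_const (c : ℝ) : OrdLT K (fun _ : Jet n => c) :=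
  ⟨admissible_const c, fun _ _ _ _ => rfl⟩

theorem ordLT_coord {γ : MI n} (h : mdeg γ < K) : OrdLT K (fun p : Jet n => p.2 γ) :=
  ⟨admissible_coord γ, fun _ _ _ h2 => h2 γ h⟩

theorem ordLT_sum {ι : Type*} (s : Finset ι) {f : ι → Jet n → ℝ}
    (h : ∀ j ∈ s, OrdLT K (f j)) : OrdLT K (∑ j ∈ s, f j) :=
  sum_induction f (OrdLT K) (fun _ _ => OrdLT.add) (ordLT_const 0) h

theorem ordLT_prod {ι : Type*} (s : Finset ι) {f : ι → Jet n → ℝ}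
    (h : ∀ j ∈ s, OrdLT K (f j)) : OrdLT K (∏ j ∈ s, f j) :=
  prod_induction f (OrdLT K) (fun _ _ => OrdLT.mul) (ordLT_const 1) h

theorem hasDerivAt_coordY {S : Finset (MI n)} {g : ((Fin n → ℝ) × (↥S → ℝ)) → ℝ}
    (hg : ContDiff ℝ (⊤ : ℕ∞) g) (h : ∀ p : Jet n, F p = g (p.1, fun a => p.2 a.1))
    {α : MI n} (hα : α ∈ S) (p : Jet n) (t : ℝ) :
    HasDerivAt (fun t => F (p.1, update p.2 α t))
      (fderiv ℝ g (p.1, fun a => update p.2 α t a.1) (0, Pi.single ⟨α, hα⟩ 1)) t := by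
  have e : ∀ t, (fun a : S => update p.2 α t a.1)
      = update (fun a : S => p.2 a.1) ⟨α, hα⟩ t := by
    intro t; ext a
    by_cases ha : a = ⟨α, hα⟩
    · subst ha; simp
    · rw [update_of_ne ha, update_of_ne (fun h => ha (Subtype.ext h))]
  simp only [h, e]
  have hd : DifferentiableAt ℝ g (p.1, update (fun a : S => p.2 a.1) ⟨α, hα⟩ t) :=
    (hg.differentiable (by simp)).differentiableAt
  exact hd.hasFDerivAt.comp_hasDerivAt t
    ((hasDerivAt_const t p.1).prodMk (hasDerivAt_update _ _ _))

theorem hasDerivAt_coordX {S : Finset (MI n)} {g : ((Fin n → ℝ) × (↥S → ℝ)) → ℝ}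
    (hg : ContDiff ℝ (⊤ : ℕ∞) g) (h : ∀ p : Jet n, F p = g (p.1, fun a => p.2 a.1))
    (i : Fin n) (p : Jet n) (t : ℝ) :
    HasDerivAt (fun t => F (update p.1 i t, p.2))
      (fderiv ℝ g (update p.1 i t, fun a => p.2 a.1) (Pi.single i 1, 0)) t := by
  simp only [h]
  have hd : DifferentiableAt ℝ g (update p.1 i t, fun a : S => p.2 a.1) :=
    (hg.differentiable (by simp)).differentiableAt
  exact hd.hasFDerivAt.comp_hasDerivAt t
    ((hasDerivAt_update _ _ _).prodMk (hasDerivAt_const t _))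

theorem differentiable_coordY (hF : Admissible F) (α : MI n) (p : Jet n) :
    Differentiable ℝ fun t => F (p.1, update p.2 α t) := by
  obtain ⟨S, hS, g, hg, h⟩ := admissible_exists_superset hF {α}
  exact fun t => (hasDerivAt_coordY hg h (singleton_subset_iff.1 hS) p t).differentiableAt

theorem differentiable_coordX (hF : Admissible F) (i : Fin n) (p : Jet n) :
    Differentiable ℝ fun t => F (update p.1 i t, p.2) := by
  obtain ⟨S, g, hg, h⟩ := hF
  exact fun t => (hasDerivAt_coordX hg h i p t).differentiableAt

theorem admissible_pdY (hF : Admissible F) (α : MI n) : Admissible (pdY α F) := by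
  obtain ⟨S, hS, g, hg, h⟩ := admissible_exists_superset hF {α}
  have hα := singleton_subset_iff.1 hS
  refine ⟨S, fun z => fderiv ℝ g z (0, Pi.single ⟨α, hα⟩ 1), ?_, fun p => ?_⟩
  · exact (hg.fderiv_right (m := (⊤ : ℕ∞)) (by simp)).clm_apply contDiff_const
  · simpa [pdY] using (hasDerivAt_coordY hg h hα p (p.2 α)).deriv

theorem admissible_pdX (hF : Admissible F) (i : Fin n) : Admissible (pdX i F) := by
  obtain ⟨S, g, hg, h⟩ := hF
  refine ⟨S, fun z => fderiv ℝ g z (Pi.single i 1, 0), ?_, fun p => ?_⟩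
  · exact (hg.fderiv_right (m := (⊤ : ℕ∞)) (by simp)).clm_apply contDiff_const
  · simpa [pdX] using (hasDerivAt_coordX hg h i p (p.1 i)).deriv

theorem pdY_add (hF : Admissible F) (hG : Admissible G) (α : MI n) :
    pdY α (F + G) = pdY α F + pdY α G :=
  funext fun p => deriv_fun_add (differentiable_coordY hF α p _) (differentiable_coordY hG α p _)

theorem pdX_add (hF : Admissible F) (hG : Admissible G) (i : Fin n) :
    pdX i (F + G) = pdX i F + pdX i G :=
  funext fun p => deriv_fun_add (differentiable_coordX hF i p _) (differentiable_coordX hG i p _)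

theorem pdY_mul (hF : Admissible F) (hG : Admissible G) (α : MI n) :
    pdY α (F * G) = pdY α F * G + F * pdY α G :=
  funext fun p => by
    simpa [pdY] using
      deriv_fun_mul (differentiable_coordY hF α p (p.2 α)) (differentiable_coordY hG α p (p.2 α))

theorem pdX_mul (hF : Admissible F) (hG : Admissible G) (i : Fin n) :
    pdX i (F * G) = pdX i F * G + F * pdX i G :=
  funext fun p => by
    simpa [pdX] using
      deriv_fun_mul (differentiable_coordX hF i p (p.1 i)) (differentiable_coordX hG i p (p.1 i))

theorem pdX_coord (i : Fin n) (γ : MI n) : pdX i (fun p : Jet n => p.2 γ) = 0 :=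
  funext fun p => by simp [pdX]

theorem pdY_coord_self (γ : MI n) : pdY γ (fun p : Jet n => p.2 γ) = 1 :=
  funext fun p => by simp [pdY]

theorem pdY_coord_of_ne {α γ : MI n} (h : α ≠ γ) : pdY α (fun p : Jet n => p.2 γ) = 0 :=
  funext fun p => by simp [pdY, update_of_ne h.symm]

theorem pdY_eq_zero (hF : DependsOnLT K F) {α : MI n} (h : K ≤ mdeg α) : pdY α F = 0 := by
  funext p
  have e : (fun t => F (p.1, update p.2 α t)) = fun _ => F p := by
    funext t
    refine hF _ _ rfl fun β hβ => update_of_ne ?_ _ _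
    rintro rfl
    omega
  simp [pdY, e]

theorem finite_support_pdY (hF : Admissible F) (p : Jet n) :
    (support fun α => pdY α F p).Finite := by
  obtain ⟨S, g, hg, h⟩ := hF
  refine S.finite_toSet.subset fun α hα => ?_
  by_contra hS
  refine hα ?_
  have e : (fun t => F (p.1, update p.2 α t)) = fun _ => F p := by
    funext t
    rw [h, h p]
    congr 2
    funext a
    refine update_of_ne ?_ _ _
    rintro rfl
    exact hS a.2
  simp [pdY, e]

theorem dependsOnLT_of_pdY (hF : Admissible F)
    (h : ∀ α : MI n, K ≤ mdeg α → pdY α F = 0) : DependsOnLT K F := by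
  classical
  intro p q hx hy
  have key : ∀ T : Finset (MI n), F (p.1, T.piecewise q.2 p.2) = F p := by
    intro T
    induction T using Finset.induction_on with
    | empty => simp
    | insert α T hα ih =>
      rw [piecewise_insert, ← ih]
      by_cases hK : mdeg α < K
      · have e : q.2 α = T.piecewise q.2 p.2 α := by
          rw [piecewise_eq_of_notMem _ _ _ hα, hy α hK]
        rw [e, update_eq_self]
      · set r := T.piecewise q.2 p.2
        have hc := is_const_of_deriv_eq_zero (differentiable_coordY hF α (p.1, r)) (fun t => by
          simpa [pdY] using congrFun (h α (not_lt.1 hK)) (p.1, update r α t)) (q.2 α) (r α)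
        simpa using hc
  obtain ⟨S, g, hg, hS⟩ := hF
  rw [← key S, hS, hS q, hx]
  congr 2
  funext a
  exact piecewise_eq_of_mem _ _ _ a.2

theorem OrdLT.pdY (hF : OrdLT K F) (α : MI n) : OrdLT K (pdY α F) := by
  by_cases hα : K ≤ mdeg α
  · rw [pdY_eq_zero hF.2 hα]
    exact ordLT_const 0
  · refine ⟨admissible_pdY hF.1 α, fun p q h1 h2 => ?_⟩
    have e : (fun t => F (p.1, update p.2 α t)) = fun t => F (q.1, update q.2 α t) := by
      funext t
      refine hF.2 _ _ h1 fun β hβ => ?_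
      by_cases hb : β = α
      · subst hb; simp
      · simp [update_of_ne hb, h2 β hβ]
    simp only [_root_.pdY, e, h2 α (not_le.1 hα)]

theorem OrdLT.pdX (hF : OrdLT K F) (i : Fin n) : OrdLT K (pdX i F) := by
  refine ⟨admissible_pdX hF.1 i, fun p q h1 h2 => ?_⟩
  have e : (fun t => F (update p.1 i t, p.2)) = fun t => F (update q.1 i t, q.2) :=
    funext fun t => hF.2 _ _ (by simp [h1]) h2
  rw [_root_.pdX, e, h1, _root_.pdX]

/-- The finset of multiindices of degree `k`. -/
def level (n k : ℕ) : Finset (MI n) := piAntidiag univ k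

@[simp]
theorem mem_level {k : ℕ} {α : MI n} : α ∈ level n k ↔ mdeg α = k := by
  simp [level, mdeg]

@[simp]
theorem mdeg_add (α β : MI n) : mdeg (α + β) = mdeg α + mdeg β := by
  simp [mdeg, sum_add_distrib]

@[simp]
theorem mdeg_single (i : Fin n) (m : ℕ) : mdeg (Pi.single i m) = m := by
  simp [mdeg]

theorem mdeg_sum {ι : Type*} (s : Finset ι) (B : ι → MI n) :
    mdeg (∑ j ∈ s, B j) = ∑ j ∈ s, mdeg (B j) := by
  simp only [mdeg, Finset.sum_apply]
  exact sum_comm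

/-- The vertical field `Σ_β e_β ∂/∂y^β`. -/
noncomputable def vert (e : MI n → Jet n → ℝ) (F : Jet n → ℝ) : Jet n → ℝ :=
  fun p => ∑ᶠ β : MI n, e β p * pdY β F p

section vert

variable (e : MI n → Jet n → ℝ)

theorem finite_support_vert (hF : Admissible F) (p : Jet n) :
    (support fun β => e β p * pdY β F p).Finite :=
  (finite_support_pdY hF p).subset (support_mul_subset_right _ _)

theorem vert_add (hF : Admissible F) (hG : Admissible G) :
    vert e (F + G) = vert e F + vert e G := by
  funext p
  simp only [vert, pdY_add hF hG, Pi.add_apply, mul_add]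
  exact finsum_add_distrib (finite_support_vert e hF p) (finite_support_vert e hG p)

theorem vert_mul (hF : Admissible F) (hG : Admissible G) :
    vert e (F * G) = vert e F * G + F * vert e G := by
  funext p
  simp only [vert, pdY_mul hF hG, Pi.add_apply, Pi.mul_apply]
  rw [finsum_mul' _ _ (finite_support_vert e hF p), mul_finsum' _ _ (finite_support_vert e hG p),
    ← finsum_add_distrib]
  · exact finsum_congr fun β => by ring
  · exact (finite_support_vert e hF p).subset (support_mul_subset_left _ _)
  · exact (finite_support_vert e hG p).subset (support_mul_subset_right _ _)

theorem vert_coord (γ : MI n) : vert e (fun p => p.2 γ) = e γ := by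
  funext p
  rw [vert, finsum_eq_single _ γ fun α hα => by simp [pdY_coord_of_ne hα]]
  simp [pdY_coord_self]

theorem vert_eq_sum (hF : DependsOnLT K F) :
    vert e F = ∑ β ∈ (range K).biUnion (level n), e β * pdY β F := by
  funext p
  rw [vert, finsum_eq_sum_of_support_subset (s := (range K).biUnion (level n))]
  · simp
  · intro β hβ
    by_contra h
    refine hβ ?_
    have : K ≤ mdeg β := by simpa using h
    simp [pdY_eq_zero hF this]

theorem vert_eq_sum_succ (hF : DependsOnLT (K + 1) F) :
    vert e F = ∑ β ∈ level n K, e β * pdY β F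
      + ∑ β ∈ (range K).biUnion (level n), e β * pdY β F := by
  rw [vert_eq_sum e hF, range_add_one, biUnion_insert, sum_union]
  rw [disjoint_left]
  intro β hβ
  simp_all

variable {e}

theorem ordLT_sum_below (hF : OrdLT N F) (he : ∀ β, mdeg β < K → OrdLT N (e β)) :
    OrdLT N (∑ β ∈ (range K).biUnion (level n), e β * pdY β F) :=
  ordLT_sum _ fun β hβ => (he β (by simpa using hβ)).mul (hF.pdY β)

theorem OrdLT.vert (hF : OrdLT K F) (hKN : K ≤ N) (he : ∀ β, mdeg β < K → OrdLT N (e β)) :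
    OrdLT N (vert e F) := by
  rw [vert_eq_sum e hF.2]
  exact ordLT_sum_below (hF.mono hKN) he

end vert

theorem totD_eq (i : Fin n) (F : Jet n → ℝ) :
    totD i F = pdX i F + vert (fun α p => p.2 (α + Pi.single i 1)) F := rfl

theorem totD_add (hF : Admissible F) (hG : Admissible G) (i : Fin n) :
    totD i (F + G) = totD i F + totD i G := by
  simp only [totD_eq, pdX_add hF hG, vert_add _ hF hG]
  ring

theorem totD_mul (hF : Admissible F) (hG : Admissible G) (i : Fin n) :
    totD i (F * G) = totD i F * G + F * totD i G := by
  simp only [totD_eq, pdX_mul hF hG, vert_mul _ hF hG]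
  ring

theorem totD_coord (i : Fin n) (γ : MI n) :
    totD i (fun p : Jet n => p.2 γ) = fun p => p.2 (γ + Pi.single i 1) := by
  rw [totD_eq, pdX_coord, vert_coord, zero_add]

theorem OrdLT.totD (hF : OrdLT K F) (i : Fin n) : OrdLT (K + 1) (totD i F) := by
  rw [totD_eq]
  exact ((hF.pdX i).mono (by omega)).add
    (hF.vert (by omega) fun β hβ => ordLT_coord (by simpa using hβ))

/-- An additive operator applied to a sum with remainder, computed termwise modulo functions of
lower order. -/
theorem exists_remainder {ι : Type*} {D : (Jet n → ℝ) → Jet n → ℝ}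
    (hadd : ∀ F G, Admissible F → Admissible G → D (F + G) = D F + D G)
    (s : Finset ι) {f T : ι → Jet n → ℝ} (hf : ∀ j ∈ s, Admissible (f j))
    (h : ∀ j ∈ s, ∃ R, OrdLT N R ∧ D (f j) = T j + R)
    {R₀ : Jet n → ℝ} (hR₀ : Admissible R₀) (hD : OrdLT N (D R₀)) :
    ∃ R, OrdLT N R ∧ D (∑ j ∈ s, f j + R₀) = ∑ j ∈ s, T j + R := by
  classical
  suffices H : Admissible (∑ j ∈ s, f j + R₀) ∧
      ∃ R, OrdLT N R ∧ D (∑ j ∈ s, f j + R₀) = ∑ j ∈ s, T j + R from H.2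
  induction s using Finset.induction_on with
  | empty => simpa using ⟨hR₀, hD⟩
  | insert j s hj ih =>
    obtain ⟨hA, R, hR, e⟩ := ih (fun i hi => hf i (mem_insert_of_mem hi))
      (fun i hi => h i (mem_insert_of_mem hi))
    have hfj := hf j (mem_insert_self j s)
    obtain ⟨R', hR', e'⟩ := h j (mem_insert_self j s)
    simp only [sum_insert hj, add_assoc]
    refine ⟨admissible_add hfj hA, R' + R, hR'.add hR, ?_⟩
    rw [hadd _ _ hfj hA, e, e']
    ring

/-- `G` has the shape of `D^δ ε`. -/
def HasTop (ε : Jet n → ℝ) (a : ℕ) (δ : MI n) (G : Jet n → ℝ) : Prop :=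
  ∃ R, OrdLT (mdeg δ + a) R ∧
    G = ∑ β ∈ level n a, (fun p : Jet n => p.2 (δ + β)) * pdY β ε + R

theorem hasTop_totD_self {ε : Jet n → ℝ} {a : ℕ} (hε : OrdLT (a + 1) ε) (i : Fin n) :
    HasTop ε a (Pi.single i 1) (totD i ε) := by
  refine ⟨pdX i ε + ∑ β ∈ (range a).biUnion (level n),
    (fun p : Jet n => p.2 (β + Pi.single i 1)) * pdY β ε, ?_, ?_⟩
  · rw [mdeg_single, add_comm]
    exact (hε.pdX i).add (ordLT_sum_below hε fun β hβ => ordLT_coord (by simpa using hβ))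
  · rw [totD_eq, vert_eq_sum_succ _ hε.2]
    simp only [add_comm (Pi.single i 1 : MI n)]
    ring

theorem HasTop.totD {ε G : Jet n → ℝ} {a : ℕ} {δ : MI n} (hε : OrdLT (a + 1) ε)
    (hδ : 0 < mdeg δ) (hG : HasTop ε a δ G) (i : Fin n) :
    HasTop ε a (δ + Pi.single i 1) (totD i G) := by
  obtain ⟨R, hR, rfl⟩ := hG
  refine exists_remainder (fun F G hF hG => totD_add hF hG i) _
    (fun β _ => admissible_mul (admissible_coord _) (admissible_pdY hε.1 β)) (fun β hβ => ?_) hR.1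
    ((hR.totD i).mono (by rw [mdeg_add, mdeg_single]; omega))
  refine ⟨(fun p => p.2 (δ + β)) * _root_.totD i (pdY β ε), ?_, ?_⟩
  · rw [mem_level] at hβ
    refine (ordLT_coord ?_).mul (((hε.pdY β).totD i).mono ?_) <;> simp <;> omega
  · rw [totD_mul (admissible_coord _) (admissible_pdY hε.1 β), totD_coord, add_right_comm]

/-- Either no derivative has been taken, or `G` has the shape of `D^δ ε`. -/
theorem hasTop_iterate {ε G : Jet n → ℝ} {a : ℕ} (hε : OrdLT (a + 1) ε) {δ : MI n}
    (hG : (δ = 0 ∧ G = ε) ∨ (0 < mdeg δ ∧ HasTop ε a δ G)) (i : Fin n) (m : ℕ) :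
    (δ + Pi.single i m = 0 ∧ (totD i)^[m] G = ε) ∨
      (0 < mdeg (δ + Pi.single i m) ∧ HasTop ε a (δ + Pi.single i m) ((totD i)^[m] G)) := by
  induction m with
  | zero => simpa using hG
  | succ m ih =>
    have e : δ + Pi.single i (m + 1) = (δ + Pi.single i m) + Pi.single i 1 := by
      rw [add_assoc, ← Pi.single_add]
    rw [e, iterate_succ_apply']
    right
    refine ⟨by simp, ?_⟩
    rcases ih with ⟨h1, h2⟩ | ⟨h1, h2⟩
    · rw [h1, h2, zero_add]
      exact hasTop_totD_self hε i
    · exact h2.totD hε h1 i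

theorem totDpow_cases {ε : Jet n → ℝ} {a : ℕ} (hε : OrdLT (a + 1) ε) (γ : MI n) :
    (γ = 0 ∧ totDpow γ ε = ε) ∨ (0 < mdeg γ ∧ HasTop ε a γ (totDpow γ ε)) := by
  have key : ∀ L : List (Fin n),
      ((L.map fun i => Pi.single (M := fun _ => ℕ) i (γ i)).sum = 0 ∧
        L.foldr (fun i G => (totD i)^[γ i] G) ε = ε) ∨
      (0 < mdeg (L.map fun i => Pi.single (M := fun _ => ℕ) i (γ i)).sum ∧
        HasTop ε a (L.map fun i => Pi.single (M := fun _ => ℕ) i (γ i)).sum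
          (L.foldr (fun i G => (totD i)^[γ i] G) ε)) := by
    intro L
    induction L with
    | nil => simp
    | cons i L ih =>
      rw [List.map_cons, List.sum_cons, List.foldr_cons, add_comm]
      exact hasTop_iterate hε ih i (γ i)
  have e : ((List.finRange n).map fun i => Pi.single (M := fun _ => ℕ) i (γ i)).sum = γ := by
    rw [← Fin.sum_univ_def, univ_sum_single]
  have h := key (List.finRange n)
  rwa [e] at h

theorem HasTop.ordLT {ε G : Jet n → ℝ} {a : ℕ} {δ : MI n} (hε : OrdLT (a + 1) ε)
    (hG : HasTop ε a δ G) : OrdLT (mdeg δ + a + 1) G := by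
  obtain ⟨R, hR, rfl⟩ := hG
  refine (ordLT_sum _ fun β hβ => ?_).add (hR.mono (by omega))
  rw [mem_level] at hβ
  exact (ordLT_coord (by simp; omega)).mul ((hε.pdY β).mono (by omega))

theorem ordLT_totDpow {ε : Jet n → ℝ} {a : ℕ} (hε : OrdLT (a + 1) ε) (γ : MI n) :
    OrdLT (mdeg γ + a + 1) (totDpow γ ε) := by
  rcases totDpow_cases hε γ with ⟨-, h2⟩ | ⟨-, h2⟩
  · rw [h2]
    exact hε.mono (by omega)
  · exact h2.ordLT hε

theorem hasTop_totDpow {ε : Jet n → ℝ} {a : ℕ} (hε : OrdLT (a + 1) ε) {γ : MI n}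
    (hγ : 0 < mdeg γ) : HasTop ε a γ (totDpow γ ε) := by
  rcases totDpow_cases hε γ with ⟨rfl, -⟩ | ⟨-, h2⟩
  · simp [mdeg] at hγ
  · exact h2

section field

variable {ξ : Fin n → Jet n → ℝ} {ε : Jet n → ℝ}

theorem XAct_eq (ξ : Fin n → Jet n → ℝ) (ε F : Jet n → ℝ) :
    XAct ξ ε F = ∑ i, ξ i * totD i F + vert (fun β => totDpow β ε) F := by
  funext p
  simp [XAct, vert]

theorem XAct_add (hF : Admissible F) (hG : Admissible G) :
    XAct ξ ε (F + G) = XAct ξ ε F + XAct ξ ε G := by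
  simp only [XAct_eq, totD_add hF hG, vert_add _ hF hG, mul_add, sum_add_distrib]
  ring

theorem XAct_mul (hF : Admissible F) (hG : Admissible G) :
    XAct ξ ε (F * G) = XAct ξ ε F * G + F * XAct ξ ε G := by
  simp only [XAct_eq, totD_mul hF hG, vert_mul _ hF hG, mul_add, add_mul, sum_add_distrib,
    sum_mul, mul_sum]
  have h1 : ∀ i, ξ i * (totD i F * G) = ξ i * totD i F * G := fun i => by ring
  have h2 : ∀ i, ξ i * (F * totD i G) = F * (ξ i * totD i G) := fun i => by ring
  simp only [h1, h2]
  ring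

theorem XAct_coord (γ : MI n) : XAct ξ ε (fun p => p.2 γ)
    = ∑ i, ξ i * (fun p : Jet n => p.2 (γ + Pi.single i 1)) + totDpow γ ε := by
  simp only [XAct_eq, totD_coord, vert_coord]

variable {a : ℕ} (ha : 1 < a) (hξ : ∀ i, OrdLT K (ξ i)) (hε : OrdLT (a + 1) ε)
include ha hξ hε

theorem ordLT_XAct (hF : OrdLT K F) : OrdLT (K + a) (XAct ξ ε F) := by
  rw [XAct_eq]
  refine (ordLT_sum _ fun i _ => ((hξ i).mono (by omega)).mul ((hF.totD i).mono (by omega))).add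
    (hF.vert (by omega) fun β hβ => (ordLT_totDpow hε β).mono (by omega))

theorem exists_XAct_coord_mul (hK : 0 < K) {γ : MI n} (hγ : mdeg γ = K) (hF : OrdLT K F) :
    ∃ R, OrdLT (K + a) R ∧ XAct ξ ε ((fun p => p.2 γ) * F)
      = ∑ β ∈ level n a, (fun p : Jet n => p.2 (γ + β)) * (pdY β ε * F) + R := by
  obtain ⟨R, hR, e⟩ := hasTop_totDpow hε (γ := γ) (by omega)
  rw [hγ] at hR
  refine ⟨(∑ i, ξ i * (fun p : Jet n => p.2 (γ + Pi.single i 1)) + R) * F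
    + (fun p => p.2 γ) * XAct ξ ε F, ?_, ?_⟩
  · refine (((ordLT_sum _ fun i _ => ((hξ i).mono (by omega)).mul (ordLT_coord ?_)).add hR).mul
      (hF.mono (by omega))).add ((ordLT_coord (by omega)).mul (ordLT_XAct ha hξ hε hF))
    simp
    omega
  · rw [XAct_mul (admissible_coord γ) hF.1, XAct_coord, e]
    simp only [← mul_assoc, ← sum_mul]
    ring

theorem exists_XAct_sum {ι : Type*} (hK : 0 < K) (s : Finset ι) {γ : ι → MI n}
    {c : ι → Jet n → ℝ} (hγ : ∀ j ∈ s, mdeg (γ j) = K) (hc : ∀ j ∈ s, OrdLT K (c j))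
    {R₀ : Jet n → ℝ} (hR₀ : OrdLT K R₀) :
    ∃ R, OrdLT (K + a) R ∧ XAct ξ ε (∑ j ∈ s, (fun p => p.2 (γ j)) * c j + R₀)
      = ∑ j ∈ s, ∑ β ∈ level n a, (fun p : Jet n => p.2 (γ j + β)) * (pdY β ε * c j) + R :=
  exists_remainder (fun _ _ => XAct_add) s
    (fun j hj => admissible_mul (admissible_coord _) (hc j hj).1)
    (fun j hj => exists_XAct_coord_mul ha hξ hε hK (hγ j hj) (hc j hj)) hR₀.1
    (ordLT_XAct ha hξ hε hR₀)

end field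

theorem exists_iterate_XAct {ξ : Fin n → Jet n → ℝ} {ε : Jet n → ℝ} {a k : ℕ} (ha : 1 < a)
    (hk : 0 < k) (hξ : ∀ i, OrdLT k (ξ i)) (hε : OrdLT (a + 1) ε) {Ψ : MI n → Jet n → ℝ}
    {ρ : Jet n → ℝ} (hΨ : ∀ γ, OrdLT k (Ψ γ)) (hρ : OrdLT k ρ) (ℓ : ℕ) :
    ∃ R, OrdLT (ℓ * a + k) R ∧
      (XAct ξ ε)^[ℓ] (∑ γ ∈ level n k, (fun p => p.2 γ) * Ψ γ + ρ)
        = ∑ z ∈ level n k ×ˢ Fintype.piFinset (fun _ : Fin ℓ => level n a),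
            (fun p : Jet n => p.2 (z.1 + ∑ j, z.2 j)) * ((∏ j, pdY (z.2 j) ε) * Ψ z.1) + R := by
  induction ℓ with
  | zero => exact ⟨ρ, by simpa using hρ, by simp⟩
  | succ ℓ ih =>
    obtain ⟨R₀, hR₀, e⟩ := ih
    rw [iterate_succ_apply', e]
    obtain ⟨R, hR, e'⟩ := exists_XAct_sum ha (fun i => (hξ i).mono (Nat.le_add_left k (ℓ * a))) hε
      (by omega) (level n k ×ˢ Fintype.piFinset (fun _ : Fin ℓ => level n a))
      (γ := fun z => z.1 + ∑ j, z.2 j) (c := fun z => (∏ j, pdY (z.2 j) ε) * Ψ z.1)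
      (fun z hz => by
        simp only [mem_product, mem_level, Fintype.mem_piFinset] at hz
        simp [mdeg_sum, hz.1, hz.2, add_comm])
      (fun z _ => (ordLT_prod _ fun j _ => (hε.pdY _).mono (by
        have := Nat.le_mul_of_pos_left a j.pos
        omega)).mul ((hΨ _).mono (by omega))) hR₀
    refine ⟨R, by rwa [add_mul, one_mul, add_right_comm], ?_⟩
    rw [e', sum_product, sum_product]
    congr 1
    refine sum_congr rfl fun γ _ => ?_
    rw [← sum_product']
    refine sum_nbij' (fun z => (Fin.cons z.2 z.1 : Fin (ℓ + 1) → MI n))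
      (fun B => (Fin.tail B, B 0)) ?_ ?_ ?_ ?_ ?_
    · rintro ⟨B, β⟩ h
      simpa [Fin.forall_fin_succ, and_comm] using h
    · intro B h
      simpa [Fin.forall_fin_succ, and_comm, Fin.tail] using h
    · rintro ⟨B, β⟩ _
      simp
    · intro B _
      simp
    · rintro ⟨B, β⟩ _
      simp only [Fin.sum_univ_succ, Fin.prod_univ_succ, Fin.cons_zero, Fin.cons_succ, mul_assoc,
        add_assoc, add_comm β]

theorem finsum_level (k : ℕ) (f : MI n → ℝ) :
    ∑ᶠ (γ : MI n) (_ : mdeg γ = k), f γ = ∑ γ ∈ level n k, f γ := by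
  simp only [← finsum_mem_coe_finset, mem_coe, mem_level]

theorem finsum_piFinset_level (a ℓ : ℕ) (f : (Fin ℓ → MI n) → ℝ) :
    ∑ᶠ (B : Fin ℓ → MI n) (_ : ∀ j, mdeg (B j) = a), f B
      = ∑ B ∈ Fintype.piFinset (fun _ : Fin ℓ => level n a), f B := by
  simp only [← finsum_mem_coe_finset, mem_coe, Fintype.mem_piFinset, mem_level]

end Jet

/-- Lemma 2, case `a > 1`. -/
theorem lemma2_case_i {n k a b ℓ : ℕ} (ha : 1 < a) (hℓ : 1 ≤ ℓ) (hkb : b < k)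
    (ξ : Fin n → Jet n → ℝ) (ε : Jet n → ℝ)
    (hξadm : ∀ i, Admissible (ξ i)) (hεadm : Admissible ε)
    (hεa : ∀ α : MI n, mdeg α > a → pdY α ε = 0)
    (hξb : ∀ i, ∀ α : MI n, mdeg α > b → pdY α (ξ i) = 0)
    (hεne : ∃ α : MI n, mdeg α = a ∧ pdY α ε ≠ 0)
    (Ψ : MI n → Jet n → ℝ) (ρ : Jet n → ℝ)
    (hΨ : ∀ γ : MI n, Admissible (Ψ γ) ∧ DependsOnLT k (Ψ γ))
    (hρ : Admissible ρ ∧ DependsOnLT k ρ)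
    (Φ : Jet n → ℝ)
    (hΦ : ∀ p : Jet n, Φ p = (∑ᶠ (γ : MI n) (_ : mdeg γ = k), p.2 γ * Ψ γ p) + ρ p) :
    ∃ R : Jet n → ℝ, Admissible R ∧
      (∀ β : MI n, mdeg β ≥ ℓ * a + k → pdY β R = 0) ∧
      ∀ p : Jet n, (XAct ξ ε)^[ℓ] Φ p =
        (∑ᶠ (γ : MI n) (_ : mdeg γ = k),
          ∑ᶠ (B : Fin ℓ → MI n) (_ : ∀ j, mdeg (B j) = a),
            p.2 (γ + ∑ j, B j) * (∏ j, pdY (B j) ε p) * Ψ γ p) + R p := by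
  obtain ⟨R, hR, e⟩ := Jet.exists_iterate_XAct ha (by omega)
    (fun i => ⟨hξadm i, Jet.dependsOnLT_of_pdY (hξadm i) fun α hα => hξb i α (by omega)⟩)
    ⟨hεadm, Jet.dependsOnLT_of_pdY hεadm fun α hα => hεa α (by omega)⟩ hΨ hρ ℓ
  have hΦ' : Φ = ∑ γ ∈ Jet.level n k, (fun p => p.2 γ) * Ψ γ + ρ := by
    funext p
    simp [hΦ, Jet.finsum_level]
  refine ⟨R, hR.1, fun β hβ => Jet.pdY_eq_zero hR.2 hβ, fun p => ?_⟩
  rw [hΦ', e]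
  simp [Jet.finsum_level, Jet.finsum_piFinset_level, Finset.sum_product, mul_assoc]
end

section
/- Let X = Σ_i ξ_i D^i + Σ_β (D^β ε) ∂/∂y^β, where ξ_1,…,ξ_n and ε are admissible functions on J^∞(ℝ^n,ℝ). Suppose there is an integer b ≥ 0 with ∂ξ_i/∂y^α = 0 for all i and all |α| > b, and suppose ∂ε/∂y^α = 0 for all |α| > 1. Let k > b and let Φ = Σ_{|γ|=k} y^γ Ψ_γ + ρ, where each Ψ_γ and ρ are admissible functions depending only on x and coordinates y^β with |β| < k. Then for every ℓ ≥ 1: X^ℓ Φ = Σ_{|γ|=k} Σ_{j_1} ⋯ Σ_{j_ℓ} y^{γ+j_1+⋯+j_ℓ} (ξ_{j_1} + ∂ε/∂y^{j_1}) ⋯ (ξ_{j_ℓ} + ∂ε/∂y^{j_ℓ}) Ψ_γ + R, where the sums over j_1,…,j_ℓ range over unit multiindices, and R is admissible with ∂R/∂y^β = 0 for every β with |β| ≥ ℓ + k. -/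
open scoped BigOperators

/-- The coordinate function `y^δ`. -/
def coordY {n : ℕ} (δ : MI n) : Jet n → ℝ := fun p => p.2 δ

/-- Admissible functions depending only on `x` and the `y^β` with `|β| < m`. -/
def OrderLT {n : ℕ} (m : ℕ) (F : Jet n → ℝ) : Prop :=
  Admissible F ∧ DependsOnLT m F

/-- The vector field `Σ_i a_i ∂/∂x_i + Σ_α c_α ∂/∂y^α` acting on functions. -/
noncomputable def vectorField {n : ℕ} (a : Fin n → Jet n → ℝ) (c : MI n → Jet n → ℝ)
    (F : Jet n → ℝ) : Jet n → ℝ :=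
  fun p => (∑ i, a i p * pdX i F p) + ∑ᶠ α : MI n, c α p * pdY α F p

section Multiindex

variable {n : ℕ}

lemma mdeg_add (α β : MI n) : mdeg (α + β) = mdeg α + mdeg β := by
  simp [mdeg, Finset.sum_add_distrib]

lemma mdeg_single (i : Fin n) : mdeg (Pi.single i 1 : MI n) = 1 := by
  simp [mdeg]

lemma mdeg_zero : mdeg (0 : MI n) = 0 := by
  simp [mdeg]

lemma mdeg_add_single (α : MI n) (i : Fin n) : mdeg (α + Pi.single i 1) = mdeg α + 1 := by
  rw [mdeg_add, mdeg_single]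

lemma mdeg_sum_single {ℓ : ℕ} (J : Fin ℓ → Fin n) :
    mdeg (∑ j, (Pi.single (J j) 1 : MI n)) = ℓ := by
  induction ℓ with
  | zero => simp [mdeg_zero]
  | succ ℓ ih =>
    rw [Fin.sum_univ_succ, mdeg_add, mdeg_single, ih (fun j => J j.succ), add_comm]

lemma eq_zero_of_mdeg_eq_zero {α : MI n} (h : mdeg α = 0) : α = 0 := by
  funext j
  simpa using (Finset.sum_eq_zero_iff.1 h) j (Finset.mem_univ j)

lemma exists_eq_single_of_mdeg_eq_one {α : MI n} (h : mdeg α = 1) :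
    ∃ j, α = Pi.single j 1 := by
  obtain ⟨j, hj⟩ : ∃ j, α j ≠ 0 := by
    by_contra! h0
    simp [mdeg, h0] at h
  have hα : α = (α - Pi.single j 1) + Pi.single j 1 := by
    funext i
    by_cases hi : i = j
    · subst hi
      simp
      omega
    · simp [hi]
  have h0 : mdeg (α - Pi.single j 1) = 0 := by
    have := congrArg mdeg hα
    rw [mdeg_add_single] at this
    omega
  refine ⟨j, ?_⟩
  rw [eq_zero_of_mdeg_eq_zero h0, zero_add] at hα
  exact hα

lemma finite_mdeg_eq (k : ℕ) : {γ : MI n | mdeg γ = k}.Finite := by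
  refine (Set.finite_Iic (fun _ => k : MI n)).subset fun γ hγ j => ?_
  rw [← show mdeg γ = k from hγ]
  exact Finset.single_le_sum (f := γ) (fun _ _ => Nat.zero_le _) (Finset.mem_univ j)

end Multiindex

section Admissible

variable {n : ℕ} {F G : Jet n → ℝ}

lemma Admissible.exists_of_subset (hF : Admissible F) :
    ∃ S : Finset (MI n), ∀ T : Finset (MI n), S ⊆ T →
      ∃ g : ((Fin n → ℝ) × (↥T → ℝ)) → ℝ,
        ContDiff ℝ (⊤ : ℕ∞) g ∧ ∀ p : Jet n, F p = g (p.1, fun a => p.2 a.1) := by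
  obtain ⟨S, g, hg, h⟩ := hF
  refine ⟨S, fun T hT => ⟨fun z => g (z.1, fun a => z.2 ⟨a.1, hT a.2⟩), ?_, fun p => h p⟩⟩
  exact hg.comp (by fun_prop)

lemma Admissible.exists_common (hF : Admissible F) (hG : Admissible G) :
    ∃ (S : Finset (MI n)) (f g : ((Fin n → ℝ) × (↥S → ℝ)) → ℝ),
      (ContDiff ℝ (⊤ : ℕ∞) f ∧ ∀ p : Jet n, F p = f (p.1, fun a => p.2 a.1)) ∧
      (ContDiff ℝ (⊤ : ℕ∞) g ∧ ∀ p : Jet n, G p = g (p.1, fun a => p.2 a.1)) := by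
  classical
  obtain ⟨S, hS⟩ := hF.exists_of_subset
  obtain ⟨T, hT⟩ := hG.exists_of_subset
  obtain ⟨f, hf⟩ := hS (S ∪ T) Finset.subset_union_left
  obtain ⟨g, hg⟩ := hT (S ∪ T) Finset.subset_union_right
  exact ⟨S ∪ T, f, g, hf, hg⟩

lemma Admissible.add (hF : Admissible F) (hG : Admissible G) : Admissible (F + G) := by
  obtain ⟨S, f, g, ⟨hf, hfF⟩, hg, hgG⟩ := hF.exists_common hG
  exact ⟨S, fun z => f z + g z, hf.add hg, fun p => by simp [hfF, hgG]⟩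

lemma Admissible.mul (hF : Admissible F) (hG : Admissible G) : Admissible (F * G) := by
  obtain ⟨S, f, g, ⟨hf, hfF⟩, hg, hgG⟩ := hF.exists_common hG
  exact ⟨S, fun z => f z * g z, hf.mul hg, fun p => by simp [hfF, hgG]⟩

lemma admissible_const (r : ℝ) : Admissible (fun _ : Jet n => r) :=
  ⟨∅, fun _ => r, contDiff_const, fun _ => rfl⟩

lemma admissible_coordY (δ : MI n) : Admissible (coordY δ) :=
  ⟨{δ}, fun z => z.2 ⟨δ, Finset.mem_singleton_self δ⟩, by fun_prop, fun _ => rfl⟩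

lemma hasDerivAt_restrict_update {ι : Type*} [DecidableEq ι] (S : Finset ι) (y : ι → ℝ) (α : ι) (t : ℝ) :
    HasDerivAt (fun t => fun a : S => Function.update y α t a.1)
      (fun a : S => if a.1 = α then 1 else 0) t := by
  refine hasDerivAt_pi.2 fun a => ?_
  by_cases h : a.1 = α
  · simpa [h] using hasDerivAt_id' t
  · simpa [h] using hasDerivAt_const t (y a.1)

lemma hasDerivAt_comp_updateY {S : Finset (MI n)} {g : ((Fin n → ℝ) × (↥S → ℝ)) → ℝ}
    (hg : ContDiff ℝ (⊤ : ℕ∞) g) (x : Fin n → ℝ) (y : MI n → ℝ) (α : MI n) (t : ℝ) :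
    HasDerivAt (fun t => g (x, fun a => Function.update y α t a.1))
      (fderiv ℝ g (x, fun a => Function.update y α t a.1)
        (0, fun a : S => if a.1 = α then 1 else 0)) t :=
  ((hg.differentiable (by simp)) _).hasFDerivAt.comp_hasDerivAt t
    ((hasDerivAt_const t x).prodMk (hasDerivAt_restrict_update S y α t))

lemma hasDerivAt_comp_updateX {S : Finset (MI n)} {g : ((Fin n → ℝ) × (↥S → ℝ)) → ℝ}
    (hg : ContDiff ℝ (⊤ : ℕ∞) g) (x : Fin n → ℝ) (y : ↥S → ℝ) (i : Fin n) (t : ℝ) :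
    HasDerivAt (fun t => g (Function.update x i t, y))
      (fderiv ℝ g (Function.update x i t, y) (Pi.single i 1, 0)) t :=
  ((hg.differentiable (by simp)) _).hasFDerivAt.comp_hasDerivAt t
    ((hasDerivAt_update x i t).prodMk (hasDerivAt_const t y))

lemma Admissible.differentiable_updateY (hF : Admissible F) (x : Fin n → ℝ) (y : MI n → ℝ)
    (α : MI n) : Differentiable ℝ (fun t => F (x, Function.update y α t)) := by
  obtain ⟨S, g, hg, h⟩ := hF
  simp only [h]
  exact fun t => (hasDerivAt_comp_updateY hg x y α t).differentiableAt

lemma Admissible.differentiable_updateX (hF : Admissible F) (x : Fin n → ℝ) (y : MI n → ℝ)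
    (i : Fin n) : Differentiable ℝ (fun t => F (Function.update x i t, y)) := by
  obtain ⟨S, g, hg, h⟩ := hF
  simp only [h]
  exact fun t => (hasDerivAt_comp_updateX hg x _ i t).differentiableAt

lemma Admissible.pdY (hF : Admissible F) (α : MI n) : Admissible (pdY α F) := by
  obtain ⟨S, g, hg, h⟩ := hF
  refine ⟨S, fun z => fderiv ℝ g z (0, fun a : S => if a.1 = α then 1 else 0),
    (hg.fderiv_right (by simp)).clm_apply contDiff_const, fun p => ?_⟩
  simp only [_root_.pdY, h]
  simpa using (hasDerivAt_comp_updateY hg p.1 p.2 α (p.2 α)).deriv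

lemma Admissible.pdX (hF : Admissible F) (i : Fin n) : Admissible (pdX i F) := by
  obtain ⟨S, g, hg, h⟩ := hF
  refine ⟨S, fun z => fderiv ℝ g z (Pi.single i 1, 0),
    (hg.fderiv_right (by simp)).clm_apply contDiff_const, fun p => ?_⟩
  simp only [_root_.pdX, h]
  simpa using (hasDerivAt_comp_updateX hg p.1 (fun a : S => p.2 a.1) i (p.1 i)).deriv

lemma Admissible.exists_pdY_eq_zero (hF : Admissible F) :
    ∃ S : Finset (MI n), ∀ α ∉ S, _root_.pdY α F = 0 := by
  obtain ⟨S, g, -, h⟩ := hF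
  refine ⟨S, fun α hα => funext fun p => ?_⟩
  have hc : (fun t => F (p.1, Function.update p.2 α t)) = fun _ => F p := by
    funext t
    rw [h, h]
    congr 2
    funext a
    exact Function.update_of_ne (fun e : a.1 = α => hα (e ▸ a.2)) _ _
  simp [_root_.pdY, hc]

lemma pdY_add (hF : Admissible F) (hG : Admissible G) (α : MI n) :
    pdY α (F + G) = pdY α F + pdY α G := by
  funext p
  exact deriv_fun_add (hF.differentiable_updateY _ _ _ _) (hG.differentiable_updateY _ _ _ _)

lemma pdX_add (hF : Admissible F) (hG : Admissible G) (i : Fin n) :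
    pdX i (F + G) = pdX i F + pdX i G := by
  funext p
  exact deriv_fun_add (hF.differentiable_updateX _ _ _ _) (hG.differentiable_updateX _ _ _ _)

lemma pdY_mul (hF : Admissible F) (hG : Admissible G) (α : MI n) :
    pdY α (F * G) = pdY α F * G + F * pdY α G := by
  funext p
  have h := deriv_fun_mul (hF.differentiable_updateY p.1 p.2 α (p.2 α))
    (hG.differentiable_updateY p.1 p.2 α (p.2 α))
  simpa [pdY] using h

lemma pdX_mul (hF : Admissible F) (hG : Admissible G) (i : Fin n) :
    pdX i (F * G) = pdX i F * G + F * pdX i G := by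
  funext p
  have h := deriv_fun_mul (hF.differentiable_updateX p.1 p.2 i (p.1 i))
    (hG.differentiable_updateX p.1 p.2 i (p.1 i))
  simpa [pdX] using h

lemma pdX_coordY (i : Fin n) (γ : MI n) : pdX i (coordY γ) = 0 := by
  funext p
  simp [pdX, coordY]

lemma pdY_coordY (α γ : MI n) (p : Jet n) :
    pdY α (coordY γ) p = if α = γ then 1 else 0 := by
  by_cases h : α = γ
  · subst h
    simp [pdY, coordY]
  · simp [pdY, coordY, h, Function.update_of_ne (Ne.symm h)]

end Admissible

section Order

variable {n m m' : ℕ} {F G : Jet n → ℝ}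

lemma OrderLT.mono (hF : OrderLT m F) (h : m ≤ m') : OrderLT m' F :=
  ⟨hF.1, fun p q h1 h2 => hF.2 p q h1 fun β hβ => h2 β (hβ.trans_le h)⟩

lemma OrderLT.add (hF : OrderLT m F) (hG : OrderLT m G) : OrderLT m (F + G) :=
  ⟨hF.1.add hG.1, fun p q h1 h2 => by simp [hF.2 p q h1 h2, hG.2 p q h1 h2]⟩

lemma OrderLT.mul (hF : OrderLT m F) (hG : OrderLT m G) : OrderLT m (F * G) :=
  ⟨hF.1.mul hG.1, fun p q h1 h2 => by simp [hF.2 p q h1 h2, hG.2 p q h1 h2]⟩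

lemma orderLT_const (r : ℝ) : OrderLT m (fun _ : Jet n => r) :=
  ⟨admissible_const r, fun _ _ _ _ => rfl⟩

lemma orderLT_coordY {δ : MI n} (h : mdeg δ < m) : OrderLT m (coordY δ) :=
  ⟨admissible_coordY δ, fun _ _ _ h2 => h2 δ h⟩

lemma OrderLT.sum {ι : Type*} (s : Finset ι) {f : ι → Jet n → ℝ}
    (h : ∀ i ∈ s, OrderLT m (f i)) : OrderLT m (∑ i ∈ s, f i) :=
  Finset.sum_induction f (OrderLT m) (fun _ _ => OrderLT.add) (orderLT_const 0) h

lemma OrderLT.prod {ι : Type*} (s : Finset ι) {f : ι → Jet n → ℝ}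
    (h : ∀ i ∈ s, OrderLT m (f i)) : OrderLT m (∏ i ∈ s, f i) :=
  Finset.prod_induction f (OrderLT m) (fun _ _ => OrderLT.mul) (orderLT_const 1) h

lemma OrderLT.pdY_eq_zero (hF : OrderLT m F) {α : MI n} (h : m ≤ mdeg α) : pdY α F = 0 := by
  funext p
  have hc : (fun t => F (p.1, Function.update p.2 α t)) = fun _ => F p := by
    funext t
    refine hF.2 _ _ rfl fun β hβ => Function.update_of_ne ?_ _ _
    rintro rfl
    omega
  simp [pdY, hc]

lemma OrderLT.pdY (hF : OrderLT m F) (α : MI n) : OrderLT m (pdY α F) := by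
  rcases le_or_gt m (mdeg α) with h | h
  · rw [hF.pdY_eq_zero h]
    exact orderLT_const 0
  refine ⟨hF.1.pdY α, fun p q h1 h2 => ?_⟩
  have hc : (fun t => F (p.1, Function.update p.2 α t)) =
      fun t => F (q.1, Function.update q.2 α t) := by
    funext t
    refine hF.2 _ _ h1 fun β hβ => ?_
    by_cases e : β = α
    · subst e
      simp
    · simp [e, h2 β hβ]
  simp only [_root_.pdY, hc, h2 α h]

lemma OrderLT.pdX (hF : OrderLT m F) (i : Fin n) : OrderLT m (pdX i F) := by
  refine ⟨hF.1.pdX i, fun p q h1 h2 => ?_⟩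
  have hc : (fun t => F (Function.update p.1 i t, p.2)) =
      fun t => F (Function.update q.1 i t, q.2) := by
    funext t
    exact hF.2 _ _ (by simp [h1]) h2
  simp only [_root_.pdX]
  rw [hc, h1]

lemma OrderLT.exists_pdY_eq_zero (hF : OrderLT m F) :
    ∃ S : Finset (MI n), (∀ α ∈ S, mdeg α < m) ∧ ∀ α ∉ S, _root_.pdY α F = 0 := by
  obtain ⟨S, hS⟩ := hF.1.exists_pdY_eq_zero
  refine ⟨S.filter fun α => mdeg α < m, fun α hα => (Finset.mem_filter.1 hα).2, fun α hα => ?_⟩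
  by_cases h : α ∈ S
  · exact hF.pdY_eq_zero (by simpa [h] using hα)
  · exact hS α h

lemma Admissible.apply_update_of_pdY_eq_zero (hF : Admissible F) {α : MI n}
    (h : _root_.pdY α F = 0) (x : Fin n → ℝ) (y : MI n → ℝ) (t : ℝ) :
    F (x, Function.update y α t) = F (x, y) := by
  have hc := is_const_of_deriv_eq_zero (hF.differentiable_updateY x y α) (fun s => by
    simpa [_root_.pdY] using congrFun h (x, Function.update y α s)) t (y α)
  simpa using hc

lemma Admissible.orderLT_of_pdY_eq_zero (hF : Admissible F)
    (h : ∀ α : MI n, m ≤ mdeg α → _root_.pdY α F = 0) : OrderLT m F := by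
  classical
  refine ⟨hF, fun p q h1 h2 => ?_⟩
  have hpw : ∀ T : Finset (MI n), (∀ α ∈ T, m ≤ mdeg α) →
      F (p.1, T.piecewise q.2 p.2) = F p := by
    intro T
    induction T using Finset.induction_on with
    | empty => simp
    | insert α T _ ih =>
      intro hT
      rw [Finset.piecewise_insert, hF.apply_update_of_pdY_eq_zero (h α (hT α (by simp)))]
      exact ih fun β hβ => hT β (by simp [hβ])
  obtain ⟨S, g, -, hg⟩ := id hF
  rw [← hpw (S.filter fun α => m ≤ mdeg α) fun α hα => (Finset.mem_filter.1 hα).2, hg, hg, h1]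
  congr 2
  funext a
  by_cases ha : m ≤ mdeg a.1
  · simp [Finset.piecewise, ha]
  · simp [Finset.piecewise, ha, h2 a.1 (by omega)]

end Order

section VectorField

variable {n m : ℕ} {F G : Jet n → ℝ} {a : Fin n → Jet n → ℝ} {c : MI n → Jet n → ℝ}

lemma finsum_mul_pdY {S : Finset (MI n)} (h : ∀ α ∉ S, pdY α F = 0) (p : Jet n)
    (f : MI n → ℝ) : ∑ᶠ α, f α * pdY α F p = ∑ α ∈ S, f α * pdY α F p := by
  refine finsum_eq_sum_of_support_subset _ fun α hα => ?_
  by_contra hS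
  exact hα (by simp [h α hS])

lemma vectorField_eq_sum {S : Finset (MI n)} (h : ∀ α ∉ S, pdY α F = 0) :
    vectorField a c F = ∑ i, a i * pdX i F + ∑ α ∈ S, c α * pdY α F := by
  funext p
  simp [vectorField, finsum_mul_pdY h]

lemma vectorField_add (hF : Admissible F) (hG : Admissible G) :
    vectorField a c (F + G) = vectorField a c F + vectorField a c G := by
  classical
  obtain ⟨S, hS⟩ := hF.exists_pdY_eq_zero
  obtain ⟨T, hT⟩ := hG.exists_pdY_eq_zero
  have h1 : ∀ α ∉ S ∪ T, pdY α F = 0 := fun α hα => hS α (by simp_all)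
  have h2 : ∀ α ∉ S ∪ T, pdY α G = 0 := fun α hα => hT α (by simp_all)
  have h3 : ∀ α ∉ S ∪ T, pdY α (F + G) = 0 := fun α hα => by
    rw [pdY_add hF hG, h1 α hα, h2 α hα, add_zero]
  rw [vectorField_eq_sum h1, vectorField_eq_sum h2, vectorField_eq_sum h3]
  simp only [pdX_add hF hG, pdY_add hF hG, mul_add, Finset.sum_add_distrib]
  ring

lemma vectorField_mul (hF : Admissible F) (hG : Admissible G) :
    vectorField a c (F * G) = vectorField a c F * G + F * vectorField a c G := by
  classical
  obtain ⟨S, hS⟩ := hF.exists_pdY_eq_zero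
  obtain ⟨T, hT⟩ := hG.exists_pdY_eq_zero
  have h1 : ∀ α ∉ S ∪ T, pdY α F = 0 := fun α hα => hS α (by simp_all)
  have h2 : ∀ α ∉ S ∪ T, pdY α G = 0 := fun α hα => hT α (by simp_all)
  have h3 : ∀ α ∉ S ∪ T, pdY α (F * G) = 0 := fun α hα => by
    rw [pdY_mul hF hG, h1 α hα, h2 α hα, zero_mul, mul_zero, add_zero]
  rw [vectorField_eq_sum h1, vectorField_eq_sum h2, vectorField_eq_sum h3]
  simp only [pdX_mul hF hG, pdY_mul hF hG, mul_add, add_mul, Finset.sum_add_distrib,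
    Finset.sum_mul, Finset.mul_sum, mul_assoc, mul_left_comm F]
  ring

lemma vectorField_zero : vectorField a c 0 = 0 := by
  funext p
  simp [vectorField, pdX, pdY]

lemma vectorField_coordY (γ : MI n) : vectorField a c (coordY γ) = c γ := by
  have h : ∀ α ∉ ({γ} : Finset (MI n)), pdY α (coordY γ) = 0 := fun α hα => by
    funext p
    simp_all [pdY_coordY]
  rw [vectorField_eq_sum h]
  funext p
  simp [pdX_coordY, pdY_coordY]

lemma vectorField_sum {ι : Type*} (s : Finset ι) {f : ι → Jet n → ℝ}
    (h : ∀ i ∈ s, Admissible (f i)) :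
    vectorField a c (∑ i ∈ s, f i) = ∑ i ∈ s, vectorField a c (f i) := by
  classical
  induction s using Finset.induction_on with
  | empty => simp [vectorField_zero]
  | insert i s hi ih =>
    have hs : Admissible (∑ i ∈ s, f i) :=
      Finset.sum_induction f Admissible (fun _ _ => Admissible.add) (admissible_const 0)
        fun j hj => h j (by simp [hj])
    rw [Finset.sum_insert hi, Finset.sum_insert hi, vectorField_add (h i (by simp)) hs,
      ih fun j hj => h j (by simp [hj])]

lemma vectorField_sum_coordY_mul {ι : Type*} (s : Finset ι) (δ : ι → MI n)
    {C : ι → Jet n → ℝ} (hC : ∀ i ∈ s, Admissible (C i)) :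
    vectorField a c (∑ i ∈ s, coordY (δ i) * C i) =
      ∑ i ∈ s, c (δ i) * C i + ∑ i ∈ s, coordY (δ i) * vectorField a c (C i) := by
  rw [vectorField_sum s fun i hi => (admissible_coordY _).mul (hC i hi),
    ← Finset.sum_add_distrib]
  refine Finset.sum_congr rfl fun i hi => ?_
  rw [vectorField_mul (admissible_coordY _) (hC i hi), vectorField_coordY]

lemma OrderLT.vectorField (hF : OrderLT m F) (ha : ∀ i, OrderLT (m + 1) (a i))
    (hc : ∀ α, mdeg α < m → OrderLT (m + 1) (c α)) : OrderLT (m + 1) (vectorField a c F) := by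
  obtain ⟨S, hSm, hS⟩ := hF.exists_pdY_eq_zero
  rw [vectorField_eq_sum hS]
  exact (OrderLT.sum _ fun i _ => (ha i).mul ((hF.pdX i).mono (by omega))).add
    (OrderLT.sum _ fun α hα => (hc α (hSm α hα)).mul ((hF.pdY α).mono (by omega)))

lemma totD_eq_vectorField (i : Fin n) (F : Jet n → ℝ) :
    totD i F = vectorField (fun j _ => if j = i then 1 else 0)
      (fun α => coordY (α + Pi.single i 1)) F := by
  funext p
  simp [totD, vectorField, coordY]

lemma OrderLT.totD (hF : OrderLT m F) (i : Fin n) : OrderLT (m + 1) (totD i F) := by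
  rw [totD_eq_vectorField]
  exact hF.vectorField (fun _ => orderLT_const _)
    fun α hα => orderLT_coordY (by rw [mdeg_add_single]; omega)

lemma XAct_eq_vectorField (ξ : Fin n → Jet n → ℝ) (ε : Jet n → ℝ) (hF : Admissible F) :
    XAct ξ ε F = vectorField ξ
      (fun α => ∑ i, ξ i * coordY (α + Pi.single i 1) + totDpow α ε) F := by
  obtain ⟨S, hS⟩ := hF.exists_pdY_eq_zero
  rw [vectorField_eq_sum hS]
  funext p
  simp only [XAct, totD, finsum_mul_pdY hS, Pi.add_apply, Finset.sum_apply, Pi.mul_apply, add_mul,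
    Finset.sum_add_distrib, mul_add, Finset.sum_mul, Finset.mul_sum, coordY]
  rw [Finset.sum_comm (s := S)]
  simp only [mul_assoc]
  ring

end VectorField

section TotalDerivative

variable {n : ℕ} {ε : Jet n → ℝ}

/-- `G` has the shape of `D^β ε` for a function `ε` of order at most one: either `β = 0` and
`G = ε`, or `G = Σ_j y^{β+j} ∂ε/∂y^j + R` with `R` of order at most `|β|`. -/
def HasLeadingPart (ε : Jet n → ℝ) (β : MI n) (G : Jet n → ℝ) : Prop :=
  (β = 0 ∧ G = ε) ∨ (1 ≤ mdeg β ∧ ∃ R, OrderLT (mdeg β + 1) R ∧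
    G = ∑ j, coordY (β + Pi.single j 1) * pdY (Pi.single j 1) ε + R)

lemma HasLeadingPart.orderLT {β : MI n} {G : Jet n → ℝ} (hε : OrderLT 2 ε)
    (h : HasLeadingPart ε β G) : OrderLT (mdeg β + 2) G := by
  rcases h with ⟨-, rfl⟩ | ⟨hβ, R, hR, rfl⟩
  · exact hε.mono (by omega)
  · exact (OrderLT.sum _ fun j _ => (orderLT_coordY (by rw [mdeg_add_single]; omega)).mul
      ((hε.pdY _).mono (by omega))).add (hR.mono (by omega))

lemma totD_eq_leading (hε : OrderLT 2 ε) (i : Fin n) :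
    totD i ε = ∑ j, coordY (Pi.single i 1 + Pi.single j 1) * pdY (Pi.single j 1) ε +
      (pdX i ε + coordY (Pi.single i 1) * pdY 0 ε) := by
  classical
  have hinj : Function.Injective (fun j : Fin n => (Pi.single j 1 : MI n)) := fun j l h => by
    by_contra hjl
    simpa [hjl] using congrFun h j
  have h0 : (0 : MI n) ∉ Finset.univ.image (fun j : Fin n => (Pi.single j 1 : MI n)) := by
    intro h
    obtain ⟨j, -, hj⟩ := Finset.mem_image.1 h
    simpa using congrFun hj j
  have hS : ∀ α ∉ insert 0 (Finset.univ.image (fun j : Fin n => (Pi.single j 1 : MI n))),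
      pdY α ε = 0 := by
    intro α hα
    refine hε.pdY_eq_zero ?_
    by_contra! hlt
    refine hα ?_
    rcases (by omega : mdeg α = 0 ∨ mdeg α = 1) with h | h
    · simp [eq_zero_of_mdeg_eq_zero h]
    · obtain ⟨j, rfl⟩ := exists_eq_single_of_mdeg_eq_one h
      simp
  funext p
  simp only [totD, finsum_mul_pdY hS]
  rw [Finset.sum_insert h0, Finset.sum_image hinj.injOn]
  simp only [Pi.add_apply, Finset.sum_apply, Pi.mul_apply, coordY, zero_add]
  simp only [add_comm (Pi.single i 1 : MI n)]
  ring

lemma HasLeadingPart.totD {β : MI n} {G : Jet n → ℝ} (hε : OrderLT 2 ε)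
    (h : HasLeadingPart ε β G) (i : Fin n) :
    HasLeadingPart ε (β + Pi.single i 1) (totD i G) := by
  refine Or.inr ⟨by rw [mdeg_add_single]; omega, ?_⟩
  rcases h with ⟨rfl, rfl⟩ | ⟨hβ, R, hR, rfl⟩
  · refine ⟨_, ?_, by rw [zero_add]; exact totD_eq_leading hε i⟩
    rw [mdeg_add_single, mdeg_zero]
    exact (hε.pdX i).add ((orderLT_coordY (by rw [mdeg_single]; omega)).mul (hε.pdY 0))
  · have hA : ∀ j ∈ (Finset.univ : Finset (Fin n)), Admissible (pdY (Pi.single j 1) ε) :=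
      fun j _ => (hε.pdY _).1
    have hsum : Admissible (∑ j, coordY (β + Pi.single j 1) * pdY (Pi.single j 1) ε) :=
      Finset.sum_induction _ Admissible (fun _ _ => Admissible.add) (admissible_const 0)
        fun j hj => (admissible_coordY _).mul (hA j hj)
    refine ⟨∑ j, coordY (β + Pi.single j 1) * _root_.totD i (pdY (Pi.single j 1) ε) +
      _root_.totD i R, ?_, ?_⟩
    · rw [mdeg_add_single]
      exact (OrderLT.sum _ fun j _ => (orderLT_coordY (by rw [mdeg_add_single]; omega)).mul
        (((hε.pdY _).totD i).mono (by omega))).add (hR.totD i)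
    · simp only [totD_eq_vectorField]
      rw [vectorField_add hsum hR.1, vectorField_sum_coordY_mul _ _ hA]
      simp only [add_right_comm β (Pi.single i 1)]
      ring

lemma HasLeadingPart.iterate_totD {β : MI n} {G : Jet n → ℝ} (hε : OrderLT 2 ε)
    (h : HasLeadingPart ε β G) (i : Fin n) (m : ℕ) :
    HasLeadingPart ε (β + Pi.single i m) ((_root_.totD i)^[m] G) := by
  induction m with
  | zero => simpa using h
  | succ m ih =>
    rw [Function.iterate_succ_apply', Pi.single_add, ← add_assoc]
    exact ih.totD hε i

lemma hasLeadingPart_totDpow (hε : OrderLT 2 ε) (α : MI n) :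
    HasLeadingPart ε α (totDpow α ε) := by
  have h : ∀ l : List (Fin n), HasLeadingPart ε (l.map fun i => (Pi.single i (α i) : MI n)).sum
      (l.foldr (fun i G => (totD i)^[α i] G) ε) := by
    intro l
    induction l with
    | nil => exact Or.inl ⟨rfl, rfl⟩
    | cons i l ih =>
      rw [List.map_cons, List.sum_cons, add_comm]
      exact ih.iterate_totD hε i (α i)
  have := h (List.finRange n)
  rwa [← Fin.sum_univ_def, Finset.univ_sum_single] at this

end TotalDerivative

section Iteration

variable {n k m : ℕ} {ξ : Fin n → Jet n → ℝ} {ε F : Jet n → ℝ}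

lemma OrderLT.XAct (hF : OrderLT m F) (hξ : ∀ i, OrderLT m (ξ i))
    (hε : OrderLT 2 ε) : OrderLT (m + 1) (XAct ξ ε F) := by
  rw [XAct_eq_vectorField ξ ε hF.1]
  refine hF.vectorField (fun i => (hξ i).mono (by omega)) fun α hα => ?_
  refine (OrderLT.sum _ fun i _ => ((hξ i).mono (by omega)).mul
    (orderLT_coordY (by rw [mdeg_add_single]; omega))).add ?_
  exact ((hasLeadingPart_totDpow hε α).orderLT hε).mono (by omega)

/-- The action of `X` on a function that is affine in the coordinates of top order `m`. -/
lemma XAct_sum_coordY_mul_add {ι : Type*} (s : Finset ι) {δ : ι → MI n} {C : ι → Jet n → ℝ}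
    {R : Jet n → ℝ} (hm : 1 ≤ m) (hξ : ∀ i, OrderLT m (ξ i)) (hε : OrderLT 2 ε)
    (hδ : ∀ i ∈ s, mdeg (δ i) = m) (hC : ∀ i ∈ s, OrderLT m (C i)) (hR : OrderLT m R) :
    ∃ R' : Jet n → ℝ, OrderLT (m + 1) R' ∧
      XAct ξ ε (∑ i ∈ s, coordY (δ i) * C i + R) =
        ∑ i ∈ s, (∑ j, coordY (δ i + Pi.single j 1) * (ξ j + pdY (Pi.single j 1) ε)) * C i +
          R' := by
  have hT : ∀ i : ι, ∃ r : Jet n → ℝ, i ∈ s → OrderLT (m + 1) r ∧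
      totDpow (δ i) ε = ∑ j, coordY (δ i + Pi.single j 1) * pdY (Pi.single j 1) ε + r := by
    intro i
    by_cases hi : i ∈ s
    · rcases hasLeadingPart_totDpow hε (δ i) with ⟨h0, -⟩ | ⟨-, r, hr, h⟩
      · have := hδ i hi
        rw [h0, mdeg_zero] at this
        omega
      · exact ⟨r, fun _ => ⟨hδ i hi ▸ hr, h⟩⟩
    · exact ⟨0, fun h => absurd h hi⟩
  choose r hr using hT
  have hS : Admissible (∑ i ∈ s, coordY (δ i) * C i) :=
    Finset.sum_induction _ Admissible (fun _ _ => Admissible.add) (admissible_const 0)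
      fun i hi => (admissible_coordY _).mul (hC i hi).1
  refine ⟨∑ i ∈ s, r i * C i + ∑ i ∈ s, coordY (δ i) * XAct ξ ε (C i) + XAct ξ ε R, ?_, ?_⟩
  · refine ((OrderLT.sum _ fun i hi => (hr i hi).1.mul ((hC i hi).mono (by omega))).add
      (OrderLT.sum _ fun i hi => ?_)).add (hR.XAct hξ hε)
    exact (orderLT_coordY (by rw [hδ i hi]; omega)).mul ((hC i hi).XAct hξ hε)
  · rw [XAct_eq_vectorField ξ ε (hS.add hR.1), vectorField_add hS hR.1,
      vectorField_sum_coordY_mul _ _ fun i hi => (hC i hi).1, XAct_eq_vectorField ξ ε hR.1,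
      ← add_assoc, ← add_assoc, add_left_inj]
    simp only [← Finset.sum_add_distrib]
    refine Finset.sum_congr rfl fun i hi => ?_
    rw [(hr i hi).2, XAct_eq_vectorField ξ ε (hC i hi).1]
    simp only [mul_add, Finset.sum_add_distrib, mul_comm (ξ _)]
    ring

/-- The shape of `X^ℓ Φ` for `Φ` affine in the coordinates of top order `k`. -/
lemma exists_iterate_XAct (hk : 1 ≤ k) (hξ : ∀ i, OrderLT k (ξ i)) (hε : OrderLT 2 ε)
    {Ψ : MI n → Jet n → ℝ} {ρ : Jet n → ℝ} (hΨ : ∀ γ, OrderLT k (Ψ γ)) (hρ : OrderLT k ρ)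
    (s : Finset (MI n)) (hs : ∀ γ ∈ s, mdeg γ = k) (ℓ : ℕ) :
    ∃ R : Jet n → ℝ, OrderLT (k + ℓ) R ∧
      (XAct ξ ε)^[ℓ] (∑ γ ∈ s, coordY γ * Ψ γ + ρ) =
        ∑ γ ∈ s, ∑ J : Fin ℓ → Fin n, coordY (γ + ∑ j, (Pi.single (J j) 1 : MI n)) *
          ((∏ j, (ξ (J j) + pdY (Pi.single (J j) 1) ε)) * Ψ γ) + R := by
  induction ℓ with
  | zero => exact ⟨ρ, hρ, by simp⟩
  | succ ℓ ih =>
    obtain ⟨R, hR, h⟩ := ih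
    have hC : ∀ z ∈ s ×ˢ (Finset.univ : Finset (Fin ℓ → Fin n)), OrderLT (k + ℓ)
        ((∏ j, (ξ (z.2 j) + pdY (Pi.single (z.2 j) 1) ε)) * Ψ z.1) := by
      intro z _
      refine OrderLT.mul (OrderLT.prod _ fun j _ => ?_) ((hΨ _).mono (by omega))
      have := j.pos
      exact ((hξ _).mono (by omega)).add ((hε.pdY _).mono (by omega))
    obtain ⟨R', hR', h'⟩ := XAct_sum_coordY_mul_add (m := k + ℓ)
      (s ×ˢ (Finset.univ : Finset (Fin ℓ → Fin n)))
      (δ := fun z => z.1 + ∑ j, (Pi.single (z.2 j) 1 : MI n)) (by omega)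
      (fun i => (hξ i).mono (by omega)) hε
      (fun z hz => by rw [mdeg_add, mdeg_sum_single, hs _ (Finset.mem_product.1 hz).1]) hC hR
    refine ⟨R', hR', ?_⟩
    rw [Finset.sum_product] at h'
    rw [Function.iterate_succ_apply', h, h', Finset.sum_product]
    congr 1
    refine Finset.sum_congr rfl fun γ _ => ?_
    rw [← (Fin.consEquiv fun _ => Fin n).sum_comp, Fintype.sum_prod_type, Finset.sum_comm]
    refine Finset.sum_congr rfl fun J _ => ?_
    rw [Finset.sum_mul]
    refine Finset.sum_congr rfl fun i _ => ?_
    simp only [Fin.consEquiv_apply, Fin.sum_univ_succ, Fin.prod_univ_succ, Fin.cons_zero,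
      Fin.cons_succ]
    rw [add_assoc, add_comm (Pi.single i 1 : MI n)]
    ring

end Iteration

/-- Lemma 2, case `a ≤ 1`. -/
theorem lemma2_case_ii {n k b ℓ : ℕ} (hℓ : 1 ≤ ℓ) (hkb : b < k)
    (ξ : Fin n → Jet n → ℝ) (ε : Jet n → ℝ)
    (hξadm : ∀ i, Admissible (ξ i)) (hεadm : Admissible ε)
    (hεa : ∀ α : MI n, mdeg α > 1 → pdY α ε = 0)
    (hξb : ∀ i, ∀ α : MI n, mdeg α > b → pdY α (ξ i) = 0)
    (Ψ : MI n → Jet n → ℝ) (ρ : Jet n → ℝ)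
    (hΨ : ∀ γ : MI n, Admissible (Ψ γ) ∧ DependsOnLT k (Ψ γ))
    (hρ : Admissible ρ ∧ DependsOnLT k ρ)
    (Φ : Jet n → ℝ)
    (hΦ : ∀ p : Jet n, Φ p = (∑ᶠ (γ : MI n) (_ : mdeg γ = k), p.2 γ * Ψ γ p) + ρ p) :
    ∃ R : Jet n → ℝ, Admissible R ∧
      (∀ β : MI n, mdeg β ≥ ℓ + k → pdY β R = 0) ∧
      ∀ p : Jet n, (XAct ξ ε)^[ℓ] Φ p =
        (∑ᶠ (γ : MI n) (_ : mdeg γ = k),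
          ∑ J : Fin ℓ → Fin n,
            p.2 (γ + ∑ j, (Pi.single (J j) 1 : MI n)) *
              (∏ j, (ξ (J j) p + pdY (Pi.single (J j) 1 : MI n) ε p)) * Ψ γ p) + R p := by
  have hε : OrderLT 2 ε := hεadm.orderLT_of_pdY_eq_zero fun α hα => hεa α hα
  have hξ : ∀ i, OrderLT k (ξ i) := fun i =>
    ((hξadm i).orderLT_of_pdY_eq_zero (m := b + 1) fun α hα => hξb i α hα).mono hkb
  have hfin : ∀ f : MI n → ℝ, ∑ᶠ (γ : MI n) (_ : mdeg γ = k), f γ =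
      ∑ γ ∈ (finite_mdeg_eq k).toFinset, f γ :=
    fun f => finsum_mem_eq_finite_toFinset_sum f (finite_mdeg_eq k)
  obtain ⟨R, hR, h⟩ := exists_iterate_XAct (by omega) hξ hε hΨ hρ
    (finite_mdeg_eq (n := n) k).toFinset (fun γ hγ => by simpa using hγ) ℓ
  refine ⟨R, hR.1, fun β hβ => hR.pdY_eq_zero (by omega), fun p => ?_⟩
  have hΦ' : Φ = ∑ γ ∈ (finite_mdeg_eq k).toFinset, coordY γ * Ψ γ + ρ := by
    funext q
    rw [hΦ, hfin]
    simp [coordY]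
  rw [hΦ', h, hfin]
  simp [coordY, mul_assoc]
end

section
/- Let X be a C^∞ vector field on ℝ^m admitting a global flow, let a_i^j : ℝ^m → ℝ (1 ≤ i, j ≤ n) be C^∞ functions, and let f_1,…,f_n : ℝ × ℝ^m → ℝ be C^∞ functions satisfying ∂f_i/∂t(t,x) = d_x f_i(t,·)(x)(X(x)) + Σ_{j=1}^n a_i^j(x) f_j(t,x) and f_i(0,x) = 0 for all x and all i. Then f_i(t,x) = 0 for all t, x and all i. -/
open scoped BigOperators

/-- A solution of a linear homogeneous ODE with continuous coefficients that vanishes at one time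
vanishes identically. -/
theorem eq_zero_of_hasDerivAt_continuousLinearMap_apply
    {E : Type*} [NormedAddCommGroup E] [NormedSpace ℝ E]
    {L : ℝ → E →L[ℝ] E} (hL : Continuous L) {g : ℝ → E}
    (hg : ∀ t, HasDerivAt g (L t (g t)) t) {t₀ : ℝ} (h₀ : g t₀ = 0) (t : ℝ) : g t = 0 := by
  obtain ⟨A, B, ht, ht₀⟩ : ∃ A B, t ∈ Set.Ioo A B ∧ t₀ ∈ Set.Ioo A B :=
    ⟨min t t₀ - 1, max t t₀ + 1, by grind, by grind⟩
  obtain ⟨C, hC⟩ := (isCompact_Icc (a := A) (b := B)).exists_bound_of_continuousOn hL.continuousOn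
  have hLip : ∀ s ∈ Set.Ioo A B, LipschitzOnWith C.toNNReal (L s) Set.univ := fun s hs =>
    ((L s).lipschitz.weaken (NNReal.le_toNNReal_of_coe_le
      (hC s (Set.Ioo_subset_Icc_self hs)))).lipschitzOnWith
  exact ODE_solution_unique_of_mem_Ioo (v := fun s => L s) (g := fun _ => (0 : E)) hLip ht₀
    (fun s _ => ⟨hg s, Set.mem_univ _⟩)
    (fun s _ => ⟨by simpa using hasDerivAt_const s (0 : E), Set.mem_univ _⟩) h₀ ht

/-- Chain rule for a function of time and position along a curve, with the time and space
derivatives taken separately. -/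
theorem DifferentiableAt.hasDerivAt_comp_curve
    {E F : Type*} [NormedAddCommGroup E] [NormedSpace ℝ E]
    [NormedAddCommGroup F] [NormedSpace ℝ F] {f : ℝ × E → F} {γ : ℝ → E} {v : E} {s : ℝ}
    (hf : DifferentiableAt ℝ f (s, γ s)) (hγ : HasDerivAt γ v s) :
    HasDerivAt (fun r => f (r, γ r))
      (deriv (fun r => f (r, γ s)) s + fderiv ℝ (fun y => f (s, y)) (γ s) v) s := by
  have h_time : HasDerivAt (fun r => f (r, γ s)) (fderiv ℝ f (s, γ s) (1, 0)) s :=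
    hf.hasFDerivAt.comp_hasDerivAt s ((hasDerivAt_id s).prodMk (hasDerivAt_const s (γ s)))
  have h_space : HasFDerivAt (fun y => f (s, y))
      ((fderiv ℝ f (s, γ s)).comp (ContinuousLinearMap.inr ℝ ℝ E)) (γ s) :=
    hf.hasFDerivAt.comp (γ s) (hasFDerivAt_prodMk_right s (γ s))
  have h_total : HasDerivAt (fun r => f (r, γ r)) (fderiv ℝ f (s, γ s) (1, v)) s :=
    hf.hasFDerivAt.comp_hasDerivAt s ((hasDerivAt_id s).prodMk hγ)
  convert h_total using 1
  rw [h_time.deriv, h_space.fderiv, ContinuousLinearMap.comp_apply, ContinuousLinearMap.inr_apply,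
    ← map_add]
  simp

/-- Lemma 5: a linear homogeneous transport system
`∂f_i/∂t = X f_i + Σ_j a_i^j f_j` with zero initial data has only the zero solution. -/
theorem lemma5 {m nn : ℕ} (X : (Fin m → ℝ) → (Fin m → ℝ)) (hX : ContDiff ℝ (⊤ : ℕ∞) X)
    (Φ : ℝ → (Fin m → ℝ) → (Fin m → ℝ))
    (hΦsmooth : ContDiff ℝ (⊤ : ℕ∞) (fun q : ℝ × (Fin m → ℝ) => Φ q.1 q.2))
    (hΦ0 : ∀ x, Φ 0 x = x)
    (hΦflow : ∀ (t : ℝ) (x : Fin m → ℝ), HasDerivAt (fun s => Φ s x) (X (Φ t x)) t)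
    (a : Fin nn → Fin nn → (Fin m → ℝ) → ℝ) (ha : ∀ i j, ContDiff ℝ (⊤ : ℕ∞) (a i j))
    (f : Fin nn → ℝ × (Fin m → ℝ) → ℝ) (hf : ∀ i, ContDiff ℝ (⊤ : ℕ∞) (f i))
    (hft : ∀ (i : Fin nn) (t : ℝ) (x : Fin m → ℝ),
      deriv (fun s => f i (s, x)) t =
        fderiv ℝ (fun y => f i (t, y)) x (X x) + ∑ j, a i j x * f j (t, x))
    (hf0 : ∀ (i : Fin nn) (x : Fin m → ℝ), f i (0, x) = 0) :
    ∀ (i : Fin nn) (t : ℝ) (x : Fin m → ℝ), f i (t, x) = 0 := by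
  intro i t x
  let γ : ℝ → Fin m → ℝ := fun s => Φ (t - s) x
  have hγ : ∀ s, HasDerivAt γ (-X (γ s)) s := fun s =>
    (hΦflow (t - s) x).comp_const_sub t s
  have hγc : Continuous γ := continuous_iff_continuousAt.2 fun s => (hγ s).continuousAt
  let L : ℝ → (Fin nn → ℝ) →L[ℝ] (Fin nn → ℝ) := fun s =>
    ∑ k, ∑ j, a k j (γ s) •
      (ContinuousLinearMap.proj (R := ℝ) (φ := fun _ : Fin nn => ℝ) j).smulRight
        (Pi.single k (1 : ℝ) : Fin nn → ℝ)
  have hL : Continuous L := continuous_finsetSum _ fun k _ => continuous_finsetSum _ fun j _ =>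
    (((ha k j).continuous.comp hγc).smul continuous_const)
  have hL_apply : ∀ s u k, L s u k = ∑ j, a k j (γ s) * u j := fun s u k => by
    simp [L, Finset.sum_apply, Pi.single_apply]
  have hg : ∀ s, HasDerivAt (fun s k => f k (s, γ s)) (L s fun k => f k (s, γ s)) s := fun s => by
    refine hasDerivAt_pi.2 fun k => ?_
    have h := (((hf k).differentiable (by simp)) (s, γ s)).hasDerivAt_comp_curve (hγ s)
    rw [hft, map_neg] at h
    rw [hL_apply]
    convert h using 1
    ring
  have h := congrFun (eq_zero_of_hasDerivAt_continuousLinearMap_apply hL hg (t₀ := 0)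
    (funext fun k => hf0 k _) t) i
  simpa [γ, hΦ0] using h
end

section
/- (Theorem 7(A)) Let V ⊆ ℝ^k be open, p ∈ V, and let X, Y_1,…,Y_ν be C^∞ vector fields on V. Let L be the smallest Lie algebra of C^∞ vector fields on V that contains Y_1,…,Y_ν and is invariant under Z ↦ [X, Z]. Suppose that on a neighborhood W of p the pointwise span {Z(q) : Z ∈ L} ⊆ ℝ^k has constant dimension ℓ ≤ k, and let g be a C^∞ function on V with Z g = 0 on V for every Z ∈ L. Then there exist a neighborhood U of p, δ > 0, and a C^∞ function f : (−δ,δ) × U → ℝ such that f(0,·) = g on U, ∂f/∂t(t,x) = d_x f(t,·)(x)(X(x)), and Y_p f(t,·) = 0 on U for every p = 1,…,ν and every t ∈ (−δ,δ). -/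
open scoped BigOperators

/-- Vector fields on (open subsets of) `ℝ^k`, as maps `ℝ^k → ℝ^k`. -/
abbrev VF (k : ℕ) := (Fin k → ℝ) → (Fin k → ℝ)

/-- The Lie bracket `[X,Y](x) = dY(x)(X(x)) − dX(x)(Y(x))`. -/
noncomputable def lieB {k : ℕ} (X Y : VF k) : VF k :=
  fun x => fderiv ℝ Y x (X x) - fderiv ℝ X x (Y x)

/-- The smallest Lie algebra of vector fields containing `Y_1, …, Y_ν` and invariant
under `Z ↦ [X, Z]`. -/
inductive genLie {k ν : ℕ} (X : VF k) (Y : Fin ν → VF k) : VF k → Prop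
  | base (p : Fin ν) : genLie X Y (Y p)
  | add {Z W : VF k} : genLie X Y Z → genLie X Y W → genLie X Y (fun x => Z x + W x)
  | smul (c : ℝ) {Z : VF k} : genLie X Y Z → genLie X Y (fun x => c • Z x)
  | bracket {Z W : VF k} : genLie X Y Z → genLie X Y W → genLie X Y (lieB Z W)
  | adX {Z : VF k} : genLie X Y Z → genLie X Y (lieB X Z)

universe u

/-- A continuous bilinear map, applied pointwise to continuous functions on a compact space. -/
noncomputable def ContinuousMap.pointwiseBilin (K : Type*) [TopologicalSpace K] [CompactSpace K]
    {E F G : Type*} [NormedAddCommGroup E] [NormedSpace ℝ E] [NormedAddCommGroup F]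
    [NormedSpace ℝ F] [NormedAddCommGroup G] [NormedSpace ℝ G] (B : G →L[ℝ] E →L[ℝ] F) :
    C(K, G) →L[ℝ] C(K, E) →L[ℝ] C(K, F) :=
  LinearMap.mkContinuous₂
    (LinearMap.mk₂ ℝ (fun (A : C(K, G)) (β : C(K, E)) =>
        (⟨fun t => B (A t) (β t), by fun_prop⟩ : C(K, F)))
      (by intros; ext; simp) (by intros; ext; simp) (by intros; ext; simp)
      (by intros; ext; simp)) ‖B‖ (by
    intro A β
    rw [ContinuousMap.norm_le _ (by positivity)]
    intro t
    calc ‖B (A t) (β t)‖ ≤ ‖B‖ * ‖A t‖ * ‖β t‖ := B.le_opNorm₂ _ _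
      _ ≤ ‖B‖ * ‖A‖ * ‖β‖ := by
        gcongr
        · exact A.norm_coe_le_norm t
        · exact β.norm_coe_le_norm t)

@[simp]
lemma ContinuousMap.pointwiseBilin_apply {K : Type*} [TopologicalSpace K] [CompactSpace K]
    {E F G : Type*} [NormedAddCommGroup E] [NormedSpace ℝ E] [NormedAddCommGroup F]
    [NormedSpace ℝ F] [NormedAddCommGroup G] [NormedSpace ℝ G] (B : G →L[ℝ] E →L[ℝ] F)
    (A : C(K, G)) (β : C(K, E)) (t : K) :
    ContinuousMap.pointwiseBilin K B A β t = B (A t) (β t) := rfl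

/-- Superposition with a `C¹` map is differentiable on spaces of continuous functions. -/
lemma ContinuousMap.hasFDerivAt_postcomp {K : Type*} [TopologicalSpace K] [CompactSpace K]
    {E F G : Type*} [NormedAddCommGroup E] [NormedSpace ℝ E] [NormedAddCommGroup F]
    [NormedSpace ℝ F] [NormedAddCommGroup G] [NormedSpace ℝ G] (B : G →L[ℝ] E →L[ℝ] F)
    (f : C(E, F)) (f' : C(E, G)) (hf : ∀ x, HasFDerivAt f (B (f' x)) x) (α : C(K, E)) :
    HasFDerivAt (fun β : C(K, E) => f.comp β)
      (ContinuousMap.pointwiseBilin K B (f'.comp α)) α := by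
  have hcont : ContinuousAt (fun β : C(K, E) => f'.comp β) α :=
    (ContinuousMap.continuous_postcomp f').continuousAt
  rw [hasFDerivAt_iff_isLittleO_nhds_zero, Asymptotics.isLittleO_iff]
  intro ε hε
  obtain ⟨η, hη, hηε⟩ : ∃ η > 0, ‖B‖ * η ≤ ε :=
    ⟨ε / (‖B‖ + 1), by positivity, by
      rw [mul_div_assoc', div_le_iff₀ (by positivity)]
      nlinarith [norm_nonneg B]⟩
  obtain ⟨δ, hδ, hball⟩ := Metric.continuousAt_iff.1 hcont η hη
  filter_upwards [Metric.ball_mem_nhds (0 : C(K, E)) hδ] with β hβ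
  rw [mem_ball_zero_iff] at hβ
  rw [ContinuousMap.norm_le _ (by positivity)]
  intro t
  have hbound : ∀ z ∈ Metric.ball (α t) δ, ‖B (f' z) - B (f' (α t))‖ ≤ ε := by
    intro z hz
    have hclose : dist (α + ContinuousMap.const K (z - α t)) α < δ := by
      rw [dist_eq_norm, add_sub_cancel_left]
      refine lt_of_le_of_lt ((ContinuousMap.norm_le _ (norm_nonneg (z - α t))).2
        fun _ => le_rfl) ?_
      rwa [← dist_eq_norm]
    have h : ‖f' z - f' (α t)‖ ≤ η := by
      simpa [dist_eq_norm] using (ContinuousMap.dist_apply_le_dist t).trans (hball hclose).le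
    rw [← map_sub]
    exact (B.le_opNorm _).trans ((mul_le_mul_of_nonneg_left h (norm_nonneg B)).trans hηε)
  have hmem : α t + β t ∈ Metric.ball (α t) δ := by
    rw [Metric.mem_ball, dist_eq_norm, add_sub_cancel_left]
    exact (β.norm_coe_le_norm t).trans_lt hβ
  have h := Convex.norm_image_sub_le_of_norm_hasFDerivWithin_le'
    (fun z _ => (hf z).hasFDerivWithinAt) hbound (convex_ball (α t) δ)
    (Metric.mem_ball_self hδ) hmem
  rw [add_sub_cancel_left] at h
  exact h.trans (mul_le_mul_of_nonneg_left (β.norm_coe_le_norm t) hε.le)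

/-- Superposition with a `C^n` map is `C^n` on spaces of continuous functions. -/
lemma ContinuousMap.contDiff_postcomp_nat {K : Type*} [TopologicalSpace K] [CompactSpace K]
    {E : Type u} [NormedAddCommGroup E] [NormedSpace ℝ E] (n : ℕ) :
    ∀ {F : Type u} [NormedAddCommGroup F] [NormedSpace ℝ F] (f : C(E, F)),
      ContDiff ℝ n f → ContDiff ℝ n (fun β : C(K, E) => f.comp β) := by
  induction n with
  | zero =>
    intro F _ _ f _
    have h : Continuous fun β : C(K, E) => f.comp β := ContinuousMap.continuous_postcomp f
    exact contDiff_zero.2 h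
  | succ n ih =>
    intro F _ _ f hf
    push_cast at hf ⊢
    obtain ⟨f', hf', hd⟩ := contDiff_succ_iff_hasFDerivAt.1 hf
    let B := ContinuousLinearMap.id ℝ (E →L[ℝ] F)
    have hL := (ContinuousMap.pointwiseBilin K B).contDiff.comp (ih ⟨f', hf'.continuous⟩ hf')
    exact contDiff_succ_iff_hasFDerivAt.2
      ⟨_, hL, fun α => ContinuousMap.hasFDerivAt_postcomp B f ⟨f', hf'.continuous⟩ hd α⟩

/-- Superposition with a smooth map is smooth on spaces of continuous functions. -/
lemma ContinuousMap.contDiff_postcomp {K : Type*} [TopologicalSpace K] [CompactSpace K]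
    {E F : Type u} [NormedAddCommGroup E] [NormedSpace ℝ E] [NormedAddCommGroup F]
    [NormedSpace ℝ F] (f : C(E, F)) (hf : ContDiff ℝ (⊤ : ℕ∞) f) :
    ContDiff ℝ (⊤ : ℕ∞) (fun β : C(K, E) => f.comp β) :=
  contDiff_infty.2 fun n => ContinuousMap.contDiff_postcomp_nat n f (contDiff_infty.1 hf n)

/-- The primitive vanishing at `0` of a continuous function on the unit interval, as a continuous
linear map. -/
noncomputable def unitPrimitive (E : Type*) [NormedAddCommGroup E] [NormedSpace ℝ E] :
    C(unitInterval, E) →L[ℝ] C(unitInterval, E) :=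
  LinearMap.mkContinuous
    { toFun := fun β => ⟨fun t => ∫ u in (0 : ℝ)..t, β (Set.projIcc 0 1 zero_le_one u), by
        have h : Continuous fun u : ℝ => β (Set.projIcc 0 1 zero_le_one u) :=
          β.continuous.comp continuous_projIcc
        exact (intervalIntegral.continuous_primitive (fun a b => h.intervalIntegrable a b) 0).comp
          continuous_subtype_val⟩
      map_add' := fun β γ => by
        ext t
        have h : ∀ β : C(unitInterval, E),
            Continuous fun u : ℝ => β (Set.projIcc 0 1 zero_le_one u) :=
          fun β => β.continuous.comp continuous_projIcc
        exact intervalIntegral.integral_add ((h β).intervalIntegrable _ _)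
          ((h γ).intervalIntegrable _ _)
      map_smul' := fun c β => by
        ext t
        exact intervalIntegral.integral_smul c _ } 1
    (fun β => by
      rw [one_mul]
      refine (ContinuousMap.norm_le _ (norm_nonneg β)).2 fun t => ?_
      refine (intervalIntegral.norm_integral_le_of_norm_le_const
        (fun u _ => β.norm_coe_le_norm _)).trans ?_
      rw [sub_zero, abs_of_nonneg t.2.1]
      exact mul_le_of_le_one_right (norm_nonneg β) t.2.2)

lemma unitPrimitive_apply {E : Type*} [NormedAddCommGroup E] [NormedSpace ℝ E]
    (β : C(unitInterval, E)) (t : unitInterval) :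
    unitPrimitive E β t = ∫ u in (0 : ℝ)..t, β (Set.projIcc 0 1 zero_le_one u) := rfl

/-- The fundamental theorem of calculus in terms of `unitPrimitive`. -/
lemma unitPrimitive_eq_sub {E : Type*} [NormedAddCommGroup E] [NormedSpace ℝ E] [CompleteSpace E]
    (β : C(unitInterval, E)) {b : ℝ → E}
    (hb : ∀ t : unitInterval, HasDerivAt b (β t) t) (t : unitInterval) :
    unitPrimitive E β t = b t - b 0 := by
  have hc : Continuous fun u : ℝ => β (Set.projIcc 0 1 zero_le_one u) :=
    β.continuous.comp continuous_projIcc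
  rw [unitPrimitive_apply]
  refine intervalIntegral.integral_eq_sub_of_hasDerivAt (fun u hu => ?_) (hc.intervalIntegrable _ _)
  rw [Set.uIcc_of_le t.2.1] at hu
  have hu' : u ∈ Set.Icc (0 : ℝ) 1 := ⟨hu.1, hu.2.trans t.2.2⟩
  rw [Set.projIcc_of_mem zero_le_one hu']
  exact hb ⟨u, hu'⟩

/-- Superposition with a smooth vector field, as a smooth vector field on the space of curves. -/
lemma exists_contDiff_superposition {E : Type u} [NormedAddCommGroup E] [NormedSpace ℝ E]
    {X : E → E} (hX : ContDiff ℝ (⊤ : ℕ∞) X) :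
    ∃ N : C(unitInterval, E) → C(unitInterval, E), ContDiff ℝ (⊤ : ℕ∞) N ∧
      (∀ α t, N α t = X (α t)) ∧
      ∀ α, ∃ D : C(unitInterval, E) →L[ℝ] C(unitInterval, E), HasFDerivAt N D α ∧
        ∀ β t, D β t = fderiv ℝ X (α t) (β t) := by
  have hX' : Continuous (fderiv ℝ X) := hX.continuous_fderiv (by simp)
  refine ⟨fun α => (⟨X, hX.continuous⟩ : C(E, E)).comp α,
    ContinuousMap.contDiff_postcomp _ hX, fun α t => rfl, fun α => ⟨_,
      ContinuousMap.hasFDerivAt_postcomp (ContinuousLinearMap.id ℝ (E →L[ℝ] E))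
        ⟨X, hX.continuous⟩ ⟨fderiv ℝ X, hX'⟩
        (fun x => (hX.differentiable (by simp) x).hasFDerivAt) α, fun β t => rfl⟩⟩

/-- A solution of the rescaled integral equation for the flow, together with the equations
satisfied by its velocity. -/
lemma flow_variational_identities {E : Type*} [NormedAddCommGroup E] [NormedSpace ℝ E]
    [CompleteSpace E] {X : E → E} (hX : Differentiable ℝ X) {s : ℝ} {x : E}
    {α N : C(unitInterval, E)} {D : C(unitInterval, E) →L[ℝ] C(unitInterval, E)}
    (hN : ∀ t, N t = X (α t)) (hD : ∀ β t, D β t = fderiv ℝ X (α t) (β t))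
    (hα : ∀ t, α t = x + s • unitPrimitive E N t) :
    (∀ t, N t = X x + s • unitPrimitive E (D N) t) ∧
    ∃ M : C(unitInterval, E), (∀ t, M t = (t : ℝ) • N t) ∧
      ∀ t, M t = unitPrimitive E N t + s • unitPrimitive E (D M) t := by
  have hc : Continuous fun u : ℝ => N (Set.projIcc 0 1 zero_le_one u) :=
    N.continuous.comp continuous_projIcc
  set a : ℝ → E := fun t => x + s • ∫ u in (0 : ℝ)..t, N (Set.projIcc 0 1 zero_le_one u) with ha
  have haα : ∀ t : unitInterval, a t = α t := fun t => by
    rw [hα t, unitPrimitive_apply]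
  have ha0 : a 0 = x := by simp [ha]
  have hda : ∀ t : unitInterval, HasDerivAt a (s • N t) t := fun t => by
    have h := (((hc.integral_hasStrictDerivAt 0 (t : ℝ)).hasDerivAt).const_smul s).const_add x
    rwa [Set.projIcc_val] at h
  have hdb : ∀ t : unitInterval, HasDerivAt (fun t => X (a t)) (s • D N t) t := fun t => by
    have h := (hX (a t)).hasFDerivAt.comp_hasDerivAt (t : ℝ) (hda t)
    rwa [map_smul, haα t, ← hD] at h
  refine ⟨fun t => ?_, ⟨⟨fun t => (t : ℝ) • N t, by fun_prop⟩, fun t => rfl, fun t => ?_⟩⟩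
  · have h := unitPrimitive_eq_sub (s • D N) (b := fun t => X (a t)) hdb t
    rw [map_smul, ContinuousMap.smul_apply] at h
    rw [h, ha0, haα, hN]
    abel
  · set M : C(unitInterval, E) := ⟨fun t => (t : ℝ) • N t, by fun_prop⟩ with hM
    have hd : ∀ t : unitInterval,
        HasDerivAt (fun t : ℝ => t • X (a t)) ((N + s • D M) t) t := fun t => by
      have h := (hasDerivAt_id (t : ℝ)).smul (hdb t)
      refine h.congr_deriv ?_
      rw [ContinuousMap.add_apply, ContinuousMap.smul_apply, hD M, hD N, hM]
      simp only [ContinuousMap.coe_mk, id_eq, one_smul, map_smul]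
      rw [haα, hN, smul_comm, add_comm]
    have h := unitPrimitive_eq_sub (N + s • D M) hd t
    rw [map_add, map_smul, ContinuousMap.add_apply, ContinuousMap.smul_apply] at h
    rw [h, haα, ← hN]
    simp [hM]

/-- Local existence and smooth dependence on time and initial condition of the flow `φ` of a
smooth vector field `X`. The last condition says that `X` is invariant under its flow. -/
theorem exists_smooth_local_flow {E : Type u} [NormedAddCommGroup E] [NormedSpace ℝ E]
    [CompleteSpace E] {X : E → E} (hX : ContDiff ℝ (⊤ : ℕ∞) X) (p : E) :
    ∃ (φ : ℝ × E → E), ∃ Ω ∈ nhds ((0 : ℝ), p),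
      (∀ z ∈ Ω, ContDiffAt ℝ (⊤ : ℕ∞) φ z) ∧ (∀ x, ((0 : ℝ), x) ∈ Ω → φ (0, x) = x) ∧
      (∀ z ∈ Ω, fderiv ℝ φ z (1, 0) = X (φ z)) ∧
      ∀ z ∈ Ω, fderiv ℝ φ z (0, X z.2) = X (φ z) := by
  obtain ⟨N, hNs, hN, hND⟩ := exists_contDiff_superposition hX
  choose D hD hDapp using hND
  let J := unitPrimitive E
  let c : E →L[ℝ] C(unitInterval, E) := ContinuousLinearMap.const ℝ unitInterval
  have hcapp : ∀ x t, c x t = x := fun x t => rfl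
  let G : ℝ × E × C(unitInterval, E) → ℝ × E × C(unitInterval, E) :=
    fun z => (z.1, z.2.1, z.2.2 - c z.2.1 - z.1 • J (N z.2.2))
  have hG : ContDiff ℝ (⊤ : ℕ∞) G := by fun_prop
  have hGd : ∀ z, DifferentiableAt ℝ G z := fun z => hG.differentiable (by simp) z
  have hG' : ∀ z w, fderiv ℝ G z w =
      (w.1, w.2.1, w.2.2 - c w.2.1 - (z.1 • J (D z.2.2 w.2.2) + w.1 • J (N z.2.2))) := by
    intro z w
    have hNz : HasFDerivAt (fun z : ℝ × E × C(unitInterval, E) => N z.2.2) _ z :=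
      (hD z.2.2).comp z
        ((hasFDerivAt_snd (𝕜 := ℝ) (p := z.2)).comp z (hasFDerivAt_snd (𝕜 := ℝ) (p := z)))
    have h1 := hasFDerivAt_fst (𝕜 := ℝ) (p := z)
    have h2 := (hasFDerivAt_fst (𝕜 := ℝ) (p := z.2)).comp z (hasFDerivAt_snd (𝕜 := ℝ) (p := z))
    have h3 := (hasFDerivAt_snd (𝕜 := ℝ) (p := z.2)).comp z (hasFDerivAt_snd (𝕜 := ℝ) (p := z))
    have h : HasFDerivAt G _ z := h1.prodMk (h2.prodMk
      ((h3.sub (c.hasFDerivAt.comp z h2)).sub (h1.smul (J.hasFDerivAt.comp z hNz))))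
    rw [h.fderiv]
    simp
  have hz₀ : ∃ e : (ℝ × E × C(unitInterval, E)) ≃L[ℝ] (ℝ × E × C(unitInterval, E)),
      (e : _ →L[ℝ] _) = fderiv ℝ G (0, p, c p) := by
    let S : (ℝ × E × C(unitInterval, E)) →L[ℝ] C(unitInterval, E) :=
      c.comp (ContinuousLinearMap.fst ℝ E _ |>.comp (ContinuousLinearMap.snd ℝ ℝ _)) +
        (ContinuousLinearMap.fst ℝ ℝ _).smulRight (J (N (c p)))
    let inv : (ℝ × E × C(unitInterval, E)) →L[ℝ] (ℝ × E × C(unitInterval, E)) :=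
      ContinuousLinearMap.id ℝ _ +
        (ContinuousLinearMap.inr ℝ ℝ (E × C(unitInterval, E))).comp
          ((ContinuousLinearMap.inr ℝ E _).comp S)
    refine ⟨ContinuousLinearEquiv.equivOfInverse (fderiv ℝ G (0, p, c p)) inv ?_ ?_, ?_⟩
    · intro w
      rw [hG']
      simp [inv, S, sub_sub]
    · intro w
      rw [hG']
      simp [inv, S, sub_sub]
    · ext <;> rfl
  obtain ⟨e₀, he₀⟩ := hz₀
  have hstrict : HasStrictFDerivAt G (e₀ : _ →L[ℝ] _) (0, p, c p) := by
    rw [he₀]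
    exact hG.contDiffAt.hasStrictFDerivAt (by simp)
  let H := hstrict.toOpenPartialHomeomorph G
  have hH : (H : _ → _) = G := hstrict.toOpenPartialHomeomorph_coe
  let ψ : ℝ × E → ℝ × E × C(unitInterval, E) := fun y => H.symm (y.1, y.2, 0)
  let α : ℝ × E → C(unitInterval, E) := fun y => (ψ y).2.2
  have hGp : G (0, p, c p) = (0, p, 0) := by simp [G]
  have htarget : ((0 : ℝ), p, (0 : C(unitInterval, E))) ∈ H.target := by
    rw [← hGp]
    exact hstrict.image_mem_toOpenPartialHomeomorph_target
  have hψ₀ : H.symm (0, p, 0) = (0, p, c p) := by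
    rw [← hGp, ← hH]
    exact H.left_inv hstrict.mem_toOpenPartialHomeomorph_source
  let Ω : Set (ℝ × E) := {y | (y.1, y.2, (0 : C(unitInterval, E))) ∈ H.target ∧
    fderiv ℝ G (ψ y) ∈ Set.range
      (ContinuousLinearEquiv.toContinuousLinearMap (σ₁₂ := RingHom.id ℝ)
        (M₁ := ℝ × E × C(unitInterval, E)) (M₂ := ℝ × E × C(unitInterval, E)))}
  have hΩ : Ω ∈ nhds ((0 : ℝ), p) := by
    have hι : Continuous fun y : ℝ × E => (y.1, y.2, (0 : C(unitInterval, E))) := by fun_prop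
    refine Filter.inter_mem (hι.continuousAt.preimage_mem_nhds (H.open_target.mem_nhds htarget)) ?_
    have hψc : ContinuousAt ψ (0, p) :=
      ContinuousAt.comp (f := fun y : ℝ × E => (y.1, y.2, (0 : C(unitInterval, E))))
        (g := H.symm) (H.continuousAt_symm htarget) hι.continuousAt
    have hfc : ContinuousAt (fun y => fderiv ℝ G (ψ y)) (0, p) :=
      (hG.continuous_fderiv (by simp)).continuousAt.comp hψc
    refine hfc.preimage_mem_nhds (ContinuousLinearEquiv.isOpen.mem_nhds ?_)
    exact ⟨e₀, by rw [he₀]; exact congrArg _ hψ₀.symm⟩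
  have hGψ : ∀ y ∈ Ω, G (ψ y) = (y.1, y.2, 0) := fun y hy => by
    rw [← hH]
    exact H.right_inv hy.1
  have hψ1 : ∀ y ∈ Ω, (ψ y).1 = y.1 := fun y hy => congrArg Prod.fst (hGψ y hy)
  have hψ2 : ∀ y ∈ Ω, (ψ y).2.1 = y.2 := fun y hy => congrArg (fun w => w.2.1) (hGψ y hy)
  have hα : ∀ y ∈ Ω, ∀ t, α y t = y.2 + y.1 • J (N (α y)) t := fun y hy t => by
    have h := congrArg (fun w => w.2.2 t) (hGψ y hy)
    simp only [G, hψ1 y hy, hψ2 y hy, ContinuousMap.sub_apply, ContinuousMap.smul_apply,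
      ContinuousMap.zero_apply, hcapp] at h
    rw [sub_sub, sub_eq_zero] at h
    exact h
  have hψs : ∀ y ∈ Ω, ContDiffAt ℝ (⊤ : ℕ∞) ψ y := fun y hy => by
    obtain ⟨e, he⟩ := hy.2
    refine ContDiffAt.comp y (H.contDiffAt_symm (f₀' := e) hy.1 ?_ ?_) (by fun_prop)
    · rw [hH, he]
      exact (hGd _).hasFDerivAt
    · rw [hH]
      exact hG.contDiffAt
  have hαs : ∀ y ∈ Ω, ContDiffAt ℝ (⊤ : ℕ∞) α y := fun y hy => (hψs y hy).snd.snd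
  have hαd : ∀ y ∈ Ω, ∀ (v : ℝ × E) (β : C(unitInterval, E)),
      (∀ t, β t = v.2 + (y.1 • J (D (α y) β) t + v.1 • J (N (α y)) t)) →
      fderiv ℝ α y v = β := by
    intro y hy v β hβ
    obtain ⟨e, he⟩ := hy.2
    have hHd : HasFDerivAt H (e : _ →L[ℝ] _) (H.symm (y.1, y.2, 0)) := by
      rw [hH, he]
      exact (hGd _).hasFDerivAt
    have hι : HasFDerivAt (fun y : ℝ × E => (y.1, y.2, (0 : C(unitInterval, E)))) _ y :=
      (hasFDerivAt_fst (𝕜 := ℝ) (p := y)).prodMk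
        ((hasFDerivAt_snd (𝕜 := ℝ) (p := y)).prodMk (hasFDerivAt_const 0 y))
    have hψd : HasFDerivAt ψ _ y := HasFDerivAt.comp y (H.hasFDerivAt_symm hy.1 hHd) hι
    have hα' : HasFDerivAt α _ y := hψd.snd.snd
    have hw : e.symm (v.1, v.2, 0) = (v.1, v.2, β) := by
      rw [ContinuousLinearEquiv.symm_apply_eq]
      have h : e (v.1, v.2, β) = fderiv ℝ G (ψ y) (v.1, v.2, β) := by rw [← he]; rfl
      rw [h, hG', hψ1 y hy]
      refine congrArg (fun b => (v.1, v.2, b)) ?_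
      ext t
      have := hβ t
      simp only [ContinuousMap.sub_apply, ContinuousMap.smul_apply, ContinuousMap.add_apply,
        ContinuousMap.zero_apply, hcapp]
      rw [sub_sub, eq_comm, sub_eq_zero]
      exact this
    rw [hα'.fderiv]
    simp [hw]
  let ev : C(unitInterval, E) →L[ℝ] E := ContinuousMap.evalCLM ℝ 1
  have hφd : ∀ y ∈ Ω, ∀ v, fderiv ℝ (fun y => ev (α y)) y v = ev (fderiv ℝ α y v) := by
    intro y hy v
    have h : HasFDerivAt (fun y => ev (α y)) _ y :=
      ev.hasFDerivAt.comp y ((hαs y hy).differentiableAt (by simp)).hasFDerivAt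
    rw [h.fderiv]
    rfl
  have hXd : Differentiable ℝ X := hX.differentiable (by simp)
  refine ⟨fun y => ev (α y), Ω, hΩ, fun y hy => ev.contDiff.contDiffAt.comp y (hαs y hy),
    fun x hx => ?_, fun y hy => ?_, fun y hy => ?_⟩
  · exact (hα _ hx 1).trans (by rw [zero_smul, add_zero])
  · obtain ⟨-, M, hM, hM'⟩ := flow_variational_identities hXd (hN (α y)) (hDapp (α y)) (hα y hy)
    rw [hφd y hy, hαd y hy (1, 0) M fun t => by
      rw [zero_add, one_smul, add_comm]
      exact hM' t]
    exact (hM 1).trans ((one_smul ℝ _).trans (hN (α y) 1))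
  · obtain ⟨h, -⟩ := flow_variational_identities hXd (hN (α y)) (hDapp (α y)) (hα y hy)
    rw [hφd y hy, hαd y hy (0, X y.2) (N (α y)) fun t => by
      rw [zero_smul, add_zero]
      exact h t]
    exact hN (α y) 1

/-- Linear independence of continuous vector fields persists near a point, with a uniform bound
on coefficients. -/
lemma eventually_norm_coeff_le {E : Type*} [NormedAddCommGroup E] [NormedSpace ℝ E] {ℓ : ℕ}
    {Z : Fin ℓ → E → E} {p : E} (hZ : ∀ i, ContinuousAt (Z i) p)
    (hp : LinearIndependent ℝ fun i => Z i p) :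
    ∃ K : ℝ, 0 ≤ K ∧ ∀ᶠ x in nhds p, ∀ c : Fin ℓ → ℝ, ‖c‖ ≤ K * ‖∑ i, c i • Z i x‖ := by
  obtain ⟨K, hK, hlip⟩ := (Fintype.linearCombination ℝ fun i => Z i p).exists_antilipschitzWith
    (LinearMap.ker_eq_bot.2
      (linearIndependent_iff_injective_fintypeLinearCombination.1 hp))
  have hbound : ∀ c : Fin ℓ → ℝ, ‖c‖ ≤ K * ‖∑ i, c i • Z i p‖ := fun c => by
    simpa [Fintype.linearCombination_apply] using hlip.le_mul_dist c 0
  have hlim : ContinuousAt (fun x => (K : ℝ) * ∑ i, ‖Z i p - Z i x‖) p := by fun_prop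
  have hsmall : ∀ᶠ x in nhds p, (K : ℝ) * ∑ i, ‖Z i p - Z i x‖ < 1 / 2 := by
    refine hlim.eventually_lt continuousAt_const ?_
    simp
  refine ⟨2 * K, by positivity, hsmall.mono fun x hx c => ?_⟩
  have hsplit : ∑ i, c i • Z i p = ∑ i, c i • Z i x + ∑ i, c i • (Z i p - Z i x) := by
    rw [← Finset.sum_add_distrib]
    exact Finset.sum_congr rfl fun i _ => by rw [← smul_add, add_sub_cancel]
  have hrest : ‖∑ i, c i • (Z i p - Z i x)‖ ≤ ‖c‖ * ∑ i, ‖Z i p - Z i x‖ := by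
    rw [Finset.mul_sum]
    refine norm_sum_le_of_le _ fun i _ => ?_
    rw [norm_smul]
    gcongr
    exact norm_le_pi_norm c i
  have h1 : ‖c‖ ≤ K * (‖∑ i, c i • Z i x‖ + ‖c‖ * ∑ i, ‖Z i p - Z i x‖) := by
    refine (hbound c).trans (mul_le_mul_of_nonneg_left ?_ K.2)
    rw [hsplit]
    exact (norm_add_le _ _).trans (by gcongr)
  nlinarith [norm_nonneg c]

/-- A solution `f` of the transport equation along `X` is annihilated by `Z₁, …, Z_ℓ` along a
reversed integral curve of `X` if it is so initially and the `[X, Z_i]` are bounded combinations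
of the `Z_j`. -/
lemma transport_annihilated {E : Type*} [NormedAddCommGroup E] [NormedSpace ℝ E] {ℓ : ℕ}
    {I : Set ℝ} {U : Set E} (hI : IsOpen I) (hU : IsOpen U) {f : ℝ × E → ℝ}
    (hf : ∀ z ∈ I ×ˢ U, ContDiffAt ℝ (⊤ : ℕ∞) f z) {X : E → E}
    (hX : ∀ x ∈ U, DifferentiableAt ℝ X x) {Z : Fin ℓ → E → E}
    (hZ : ∀ i, ∀ x ∈ U, DifferentiableAt ℝ (Z i) x)
    (htrans : ∀ z ∈ I ×ˢ U, fderiv ℝ f z (1, 0) = fderiv ℝ f z (0, X z.2))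
    (hstart : ∀ i, ∀ x ∈ U, fderiv ℝ f (0, x) (0, Z i x) = 0) {K : ℝ}
    (hK : ∀ i, ∀ x ∈ U, ∃ c : Fin ℓ → ℝ,
      VectorField.lieBracket ℝ X (Z i) x = ∑ j, c j • Z j x ∧ ‖c‖ ≤ K)
    {t : ℝ} (ht : ∀ σ ∈ Set.Icc (0 : ℝ) 1, t * σ ∈ I) {γ : ℝ → E}
    (hγU : ∀ σ ∈ Set.Icc (0 : ℝ) 1, γ σ ∈ U)
    (hγ : ∀ σ ∈ Set.Icc (0 : ℝ) 1, HasDerivAt γ (-t • X (γ σ)) σ) (i : Fin ℓ) :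
    fderiv ℝ f (t, γ 1) (0, Z i (γ 1)) = 0 := by
  let h : Fin ℓ → ℝ × E → ℝ := fun i z => fderiv ℝ f z (0, Z i z.2)
  have hlift : ∀ (a : ℝ) (W : E → E) (z : ℝ × E), DifferentiableAt ℝ W z.2 →
      HasFDerivAt (fun z : ℝ × E => (a, W z.2)) ((0 : ℝ × E →L[ℝ] ℝ).prod
        ((fderiv ℝ W z.2).comp (ContinuousLinearMap.snd ℝ ℝ E))) z := fun a W z hW =>
    (hasFDerivAt_const a z).prodMk (hW.hasFDerivAt.comp z hasFDerivAt_snd)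
  have hhd : ∀ i, ∀ z ∈ I ×ˢ U, DifferentiableAt ℝ (h i) z := fun i z hz =>
    ((((hf z hz).fderiv_right (m := (⊤ : ℕ∞)) (by simp)).differentiableAt (by simp))).clm_apply
      (hlift 0 (Z i) z (hZ i _ hz.2)).differentiableAt
  have hflow : ∀ i, ∀ z ∈ I ×ˢ U, fderiv ℝ (h i) z (1, -X z.2) =
      -fderiv ℝ f z (0, VectorField.lieBracket ℝ X (Z i) z.2) := by
    intro i z hz
    have hN := hlift 1 (fun x => -X x) z (hX _ hz.2).neg
    have hZi := hlift 0 (Z i) z (hZ i _ hz.2)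
    have hbr := VectorField.fderiv_apply_lieBracket (hf z hz)
      (by simpa using WithTop.coe_le_coe.2 (le_top : (2 : ℕ∞) ≤ ⊤))
      hZi.differentiableAt hN.differentiableAt
    have hzero : (fun z => fderiv ℝ f z (1, -X z.2)) =ᶠ[nhds z] fun _ => (0 : ℝ) := by
      filter_upwards [(hI.prod hU).mem_nhds hz] with y hy
      have : ((1 : ℝ), -X y.2) = (1, 0) - (0, X y.2) := by simp
      rw [this, map_sub, htrans y hy, sub_self]
    rw [hzero.fderiv_eq] at hbr
    simp only [fderiv_const_apply, zero_apply, sub_zero] at hbr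
    rw [← hbr, ← map_neg, VectorField.lieBracket, hZi.fderiv, hN.fderiv]
    congr 1
    simp [VectorField.lieBracket, fderiv_fun_neg]
    abel
  let u : ℝ → Fin ℓ → ℝ := fun σ i => h i (t * σ, γ σ)
  have hmem : ∀ σ ∈ Set.Icc (0 : ℝ) 1, (t * σ, γ σ) ∈ I ×ˢ U := fun σ hσ => ⟨ht σ hσ, hγU σ hσ⟩
  have hu : ∀ σ ∈ Set.Icc (0 : ℝ) 1, HasDerivAt u
      (fun i => t * -fderiv ℝ f (t * σ, γ σ) (0, VectorField.lieBracket ℝ X (Z i) (γ σ))) σ := by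
    intro σ hσ
    refine hasDerivAt_pi.2 fun i => ?_
    have hcurve : HasDerivAt (fun σ => (t * σ, γ σ)) (t • ((1 : ℝ), -X (γ σ))) σ := by
      have := ((hasDerivAt_id σ).const_mul t).prodMk (hγ σ hσ)
      simpa using this
    have hd := (hhd i _ (hmem σ hσ)).hasFDerivAt.comp_hasDerivAt σ hcurve
    rwa [map_smul, smul_eq_mul, hflow i _ (hmem σ hσ)] at hd
  have hbound : ∀ σ ∈ Set.Icc (0 : ℝ) 1,
      ‖(fun i => t * -fderiv ℝ f (t * σ, γ σ)
        (0, VectorField.lieBracket ℝ X (Z i) (γ σ)) : Fin ℓ → ℝ)‖ ≤ |t| * (ℓ * K) * ‖u σ‖ := by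
    intro σ hσ
    have hK0 : ∀ i : Fin ℓ, 0 ≤ K := fun i => by
      obtain ⟨c, -, hc⟩ := hK i _ (hγU σ hσ)
      exact (norm_nonneg c).trans hc
    rcases isEmpty_or_nonempty (Fin ℓ) with hℓ | ⟨⟨i₀⟩⟩
    · simp [Subsingleton.elim (u σ) 0, Pi.norm_def]
    have := hK0 i₀
    refine (pi_norm_le_iff_of_nonneg (by positivity)).2 fun i => ?_
    obtain ⟨c, hc, hcK⟩ := hK i _ (hγU σ hσ)
    have hsum : fderiv ℝ f (t * σ, γ σ) (0, VectorField.lieBracket ℝ X (Z i) (γ σ)) =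
        ∑ j, c j * u σ j := by
      have : ((0 : ℝ), VectorField.lieBracket ℝ X (Z i) (γ σ)) =
          ∑ j, c j • ((0 : ℝ), Z j (γ σ)) := by
        rw [hc]
        ext1 <;> simp [Prod.fst_sum, Prod.snd_sum]
      rw [this, map_sum]
      exact Finset.sum_congr rfl fun j _ => by rw [map_smul, smul_eq_mul]
    rw [hsum, norm_mul, norm_neg, mul_assoc, Real.norm_eq_abs t]
    refine mul_le_mul_of_nonneg_left ?_ (abs_nonneg t)
    calc ‖∑ j, c j * u σ j‖ ≤ ∑ _j : Fin ℓ, K * ‖u σ‖ := by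
          refine norm_sum_le_of_le _ fun j _ => ?_
          rw [norm_mul]
          gcongr
          · exact (norm_le_pi_norm c j).trans hcK
          · exact norm_le_pi_norm (u σ) j
      _ = ℓ * K * ‖u σ‖ := by simp [mul_assoc]
  have hu0 : u 0 = 0 := by
    ext i
    simpa [u, h] using hstart i _ (hγU 0 ⟨le_rfl, zero_le_one⟩)
  have h1 := eq_zero_of_abs_deriv_le_mul_abs_self_of_eq_zero_right
    (fun σ hσ => (hu σ hσ).continuousAt.continuousWithinAt)
    (fun σ hσ => (hu σ ⟨hσ.1, hσ.2.le⟩).hasDerivWithinAt) hu0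
    (fun σ hσ => hbound σ ⟨hσ.1, hσ.2.le⟩) 1 ⟨zero_le_one, le_rfl⟩
  simpa [u, h] using congrFun h1 i

lemma genLie.contDiffAt {k ν : ℕ} {X : VF k} {Y : Fin ν → VF k} {x : Fin k → ℝ}
    (hX : ContDiffAt ℝ (⊤ : ℕ∞) X x) (hY : ∀ q, ContDiffAt ℝ (⊤ : ℕ∞) (Y q) x) {Z : VF k}
    (hZ : genLie X Y Z) : ContDiffAt ℝ (⊤ : ℕ∞) Z x := by
  induction hZ with
  | base q => exact hY q
  | add _ _ h₁ h₂ => exact h₁.add h₂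
  | smul c _ h => exact h.const_smul c
  | bracket _ _ h₁ h₂ => exact h₁.lieBracket_vectorField h₂ (by simp)
  | adX _ h => exact hX.lieBracket_vectorField h (by simp)

/-- A family of vector fields of constant pointwise rank near `p` has a local frame consisting of
members of the family, with uniformly bounded coefficients. -/
lemma exists_local_frame {E : Type*} [NormedAddCommGroup E] [NormedSpace ℝ E]
    [FiniteDimensional ℝ E] {L : (E → E) → Prop} {p : E} (hL : ∀ Z, L Z → ContinuousAt Z p)
    {ℓ : ℕ} (hrank : ∀ᶠ x in nhds p,
      Module.finrank ℝ (Submodule.span ℝ {v : E | ∃ Z, L Z ∧ v = Z x}) = ℓ) :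
    ∃ Z : Fin ℓ → E → E, (∀ i, L (Z i)) ∧ ∃ K : ℝ, 0 ≤ K ∧ ∀ᶠ x in nhds p,
      ∀ W, L W → ∃ c : Fin ℓ → ℝ, W x = ∑ i, c i • Z i x ∧ ‖c‖ ≤ K * ‖W x‖ := by
  obtain rfl := hrank.self_of_nhds
  obtain ⟨v, hv, -, hli⟩ :=
    Submodule.exists_fun_fin_finrank_span_eq ℝ {v : E | ∃ Z, L Z ∧ v = Z p}
  choose Z hZ hvZ using hv
  obtain rfl : v = fun i => Z i p := funext hvZ
  obtain ⟨K, hK, hev⟩ := eventually_norm_coeff_le (fun i => hL _ (hZ i)) hli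
  refine ⟨Z, hZ, K, hK, (hev.and hrank).mono fun x ⟨hx, hr⟩ W hW => ?_⟩
  have hinj : LinearIndependent ℝ fun i => Z i x := by
    rw [Fintype.linearIndependent_iff]
    intro c hc i
    have h := hx c
    rw [hc, norm_zero, mul_zero] at h
    exact congrFun (norm_le_zero_iff.1 h) i
  have hle : Submodule.span ℝ (Set.range fun i => Z i x) ≤
      Submodule.span ℝ {v : E | ∃ Z, L Z ∧ v = Z x} := by
    refine Submodule.span_mono ?_
    rintro _ ⟨i, rfl⟩
    exact ⟨Z i, hZ i, rfl⟩
  have heq := Submodule.eq_of_le_of_finrank_eq hle (by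
    rw [hr, finrank_span_eq_card hinj, Fintype.card_fin])
  have hmem : W x ∈ Submodule.span ℝ (Set.range fun i => Z i x) := by
    rw [heq]
    exact Submodule.subset_span ⟨W, hW, rfl⟩
  obtain ⟨c, hc⟩ := (Submodule.mem_span_range_iff_exists_fun ℝ).1 hmem
  exact ⟨c, hc.symm, hc ▸ hx c⟩

/-- A vector field that is smooth near a point agrees near that point with a globally smooth
one. -/
lemma exists_contDiff_eventuallyEq {E : Type*} [NormedAddCommGroup E] [NormedSpace ℝ E]
    [FiniteDimensional ℝ E] {V : Set E} (hV : IsOpen V) {p : E} (hp : p ∈ V) {X : E → E}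
    (hX : ContDiffOn ℝ (⊤ : ℕ∞) X V) :
    ∃ X' : E → E, ContDiff ℝ (⊤ : ℕ∞) X' ∧ X' =ᶠ[nhds p] X := by
  obtain ⟨r, hr, hrV⟩ := Metric.nhds_basis_closedBall.mem_iff.1 (hV.mem_nhds hp)
  let χ : ContDiffBump p := ⟨r / 2, r, half_pos hr, half_lt_self hr⟩
  refine ⟨fun x => χ x • X x, contDiff_iff_contDiffAt.2 fun x => ?_, ?_⟩
  · by_cases hx : x ∈ V
    · exact χ.contDiff.contDiffAt.smul (hX.contDiffAt (hV.mem_nhds hx))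
    · have hx' : x ∉ tsupport χ := fun h => hx (hrV (by rwa [χ.tsupport_eq] at h))
      refine (contDiffAt_const (c := (0 : E))).congr_of_eventuallyEq ?_
      filter_upwards [notMem_tsupport_iff_eventuallyEq.1 hx'] with y hy
      rw [hy, Pi.zero_apply, zero_smul]
  · filter_upwards [χ.eventuallyEq_one] with x hx
    rw [hx, Pi.one_apply, one_smul]

/-- Theorem 7(A): if the Lie algebra `L` generated by `Y_1,…,Y_ν` and
invariant under `ad_X` has constant pointwise rank `ℓ` near `p`, and `g` is annihilated
by `L`, then the transport problem with initial datum `g` has a local solution `f`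
annihilated by the `Y_p`. -/
theorem theorem7A {k ν : ℕ} (ℓ : ℕ) (hℓ : ℓ ≤ k)
    (V : Set (Fin k → ℝ)) (hV : IsOpen V) (p : Fin k → ℝ) (hp : p ∈ V)
    (X : VF k) (hX : ContDiffOn ℝ (⊤ : ℕ∞) X V)
    (Y : Fin ν → VF k) (hY : ∀ q, ContDiffOn ℝ (⊤ : ℕ∞) (Y q) V)
    (hrank : ∃ W ∈ nhds p, W ⊆ V ∧ ∀ q ∈ W,
      Module.finrank ℝ
        (Submodule.span ℝ {v : Fin k → ℝ | ∃ Z : VF k, genLie X Y Z ∧ v = Z q}) = ℓ)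
    (g : (Fin k → ℝ) → ℝ) (hg : ContDiffOn ℝ (⊤ : ℕ∞) g V)
    (hgann : ∀ Z : VF k, genLie X Y Z → ∀ x ∈ V, fderiv ℝ g x (Z x) = 0) :
    ∃ U ∈ nhds p, U ⊆ V ∧ ∃ δ : ℝ, 0 < δ ∧ ∃ f : ℝ × (Fin k → ℝ) → ℝ,
      ContDiffOn ℝ (⊤ : ℕ∞) f (Set.Ioo (-δ) δ ×ˢ U) ∧
      (∀ x ∈ U, f (0, x) = g x) ∧
      (∀ t ∈ Set.Ioo (-δ) δ, ∀ x ∈ U,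
        deriv (fun s => f (s, x)) t = fderiv ℝ (fun y => f (t, y)) x (X x)) ∧
      (∀ q : Fin ν, ∀ t ∈ Set.Ioo (-δ) δ, ∀ x ∈ U,
        fderiv ℝ (fun y => f (t, y)) x (Y q x) = 0) := by
  have hXat : ∀ x ∈ V, ContDiffAt ℝ (⊤ : ℕ∞) X x := fun x hx => hX.contDiffAt (hV.mem_nhds hx)
  have hLat : ∀ Z, genLie X Y Z → ∀ x ∈ V, ContDiffAt ℝ (⊤ : ℕ∞) Z x := fun Z hZ x hx =>
    hZ.contDiffAt (hXat x hx) fun q => (hY q).contDiffAt (hV.mem_nhds hx)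
  obtain ⟨Z, hZ, K, hK, hframe⟩ := exists_local_frame (L := genLie X Y)
    (fun Z hZ => (hLat Z hZ p hp).continuousAt) (by
      obtain ⟨W, hW, -, hr⟩ := hrank
      exact Filter.eventually_of_mem hW hr)
  obtain ⟨X', hX', hXX'⟩ := exists_contDiff_eventuallyEq hV hp hX
  obtain ⟨φ, Ω, hΩ, hφs, hφ0, hφt, hφx⟩ := exists_smooth_local_flow hX' p
  obtain ⟨M, hM⟩ : ∃ M : ℝ, ∀ᶠ x in nhds p, ∀ i, ‖lieB X (Z i) x‖ ≤ M := by
    have hc : ContinuousAt (fun x => ∑ i, ‖lieB X (Z i) x‖) p := by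
      refine tendsto_finsetSum _ fun i _ => ?_
      exact (hLat _ ((hZ i).adX) p hp).continuousAt.norm
    refine ⟨∑ i, ‖lieB X (Z i) p‖ + 1, ?_⟩
    filter_upwards [hc.eventually_lt continuousAt_const (lt_add_one _)] with x hx i
    exact (Finset.single_le_sum (f := fun i => ‖lieB X (Z i) x‖) (fun _ _ => norm_nonneg _)
      (Finset.mem_univ i)).trans hx.le
  obtain ⟨B, hBp, hB, hpB⟩ := eventually_nhds_iff.1
    ((hV.eventually_mem hp).and (hXX'.and (hframe.and hM)))
  have hφp : φ (0, p) = p := hφ0 p (mem_of_mem_nhds hΩ)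
  have hφc : ContinuousAt φ (0, p) := (hφs _ (mem_of_mem_nhds hΩ)).continuousAt
  have hshrink : ∀ A : Set (Fin k → ℝ), A ∈ nhds p → ∀ O ∈ nhds ((0 : ℝ), p), ∃ δ : ℝ, 0 < δ ∧
      ∃ U, IsOpen U ∧ p ∈ U ∧ ∀ z ∈ Set.Ioo (-δ) δ ×ˢ U, z ∈ O ∧ φ z ∈ A := by
    intro A hA O hO
    have hmem := Filter.inter_mem hO (hφc.preimage_mem_nhds (by rwa [hφp]))
    obtain ⟨u, hu, w, hw, huw⟩ := mem_nhds_prod_iff.1 hmem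
    obtain ⟨δ, hδ, hδu⟩ := Metric.mem_nhds_iff.1 hu
    obtain ⟨U, hUw, hU, hpU⟩ := mem_nhds_iff.1 hw
    refine ⟨δ, hδ, U, hU, hpU, fun z hz => huw ⟨hδu ?_, hUw hz.2⟩⟩
    rw [Real.ball_eq_Ioo, zero_sub, zero_add]
    exact hz.1
  obtain ⟨δ₀, hδ₀, U₀, hU₀, hpU₀, h₀⟩ := hshrink B (hB.mem_nhds hpB)
    (Ω ∩ Prod.snd ⁻¹' B)
    (Filter.inter_mem hΩ (continuous_snd.continuousAt.preimage_mem_nhds (hB.mem_nhds hpB)))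
  obtain ⟨δ, hδ, U, hU, hpU, h₁⟩ := hshrink U₀ (hU₀.mem_nhds hpU₀) (Set.Ioo (-δ₀) δ₀ ×ˢ U₀)
    ((isOpen_Ioo.prod hU₀).mem_nhds ⟨⟨by linarith, hδ₀⟩, hpU₀⟩)
  let f : ℝ × (Fin k → ℝ) → ℝ := fun z => g (φ z)
  have hΩ₀ : ∀ z ∈ Set.Ioo (-δ₀) δ₀ ×ˢ U₀, z ∈ Ω := fun z hz => (h₀ z hz).1.1
  have hU₀B : ∀ x ∈ U₀, x ∈ B := fun x hx => (h₀ (0, x) ⟨⟨by linarith, hδ₀⟩, hx⟩).1.2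
  have hgat : ∀ z ∈ Set.Ioo (-δ₀) δ₀ ×ˢ U₀, ContDiffAt ℝ (⊤ : ℕ∞) g (φ z) := fun z hz =>
    hg.contDiffAt (hV.mem_nhds (hBp _ (h₀ z hz).2).1)
  have hfs : ∀ z ∈ Set.Ioo (-δ₀) δ₀ ×ˢ U₀, ContDiffAt ℝ (⊤ : ℕ∞) f z := fun z hz =>
    (hgat z hz).comp z (hφs z (hΩ₀ z hz))
  have hfd : ∀ z ∈ Set.Ioo (-δ₀) δ₀ ×ˢ U₀, ∀ w,
      fderiv ℝ f z w = fderiv ℝ g (φ z) (fderiv ℝ φ z w) := fun z hz w => by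
    rw [fderiv_fun_comp z ((hgat z hz).differentiableAt (by simp))
      ((hφs z (hΩ₀ z hz)).differentiableAt (by simp))]
    rfl
  have htrans : ∀ z ∈ Set.Ioo (-δ₀) δ₀ ×ˢ U₀,
      fderiv ℝ f z (1, 0) = fderiv ℝ f z (0, X z.2) := fun z hz => by
    rw [hfd z hz, hfd z hz, hφt z (hΩ₀ z hz), ← (hBp _ (hU₀B _ hz.2)).2.1, hφx z (hΩ₀ z hz)]
  have hpartial : ∀ t x, (t, x) ∈ Set.Ioo (-δ₀) δ₀ ×ˢ U₀ → ∀ v,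
      fderiv ℝ (fun y => f (t, y)) x v = fderiv ℝ f (t, x) (0, v) := fun t x hz v => by
    have h : HasFDerivAt (fun y => f (t, y)) _ x :=
      ((hfs _ hz).differentiableAt (by simp)).hasFDerivAt.comp x (hasFDerivAt_prodMk_right t x)
    rw [h.fderiv]
    rfl
  have hf0 : ∀ x ∈ U₀, f (0, x) = g x := fun x hx =>
    congrArg g (hφ0 x (hΩ₀ _ ⟨⟨by linarith, hδ₀⟩, hx⟩))
  have hstart : ∀ i, ∀ x ∈ U₀, fderiv ℝ f (0, x) (0, Z i x) = 0 := fun i x hx => by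
    rw [← hpartial 0 x ⟨⟨by linarith, hδ₀⟩, hx⟩]
    have heq : (fun y => f (0, y)) =ᶠ[nhds x] g :=
      Filter.eventually_of_mem (hU₀.mem_nhds hx) hf0
    rw [heq.fderiv_eq]
    exact hgann _ (hZ i) x (hBp x (hU₀B x hx)).1
  have hbracket : ∀ i, ∀ x ∈ U₀, ∃ c : Fin ℓ → ℝ,
      VectorField.lieBracket ℝ X (Z i) x = ∑ j, c j • Z j x ∧ ‖c‖ ≤ K * M := fun i x hx => by
    obtain ⟨-, -, hfr, hMx⟩ := hBp x (hU₀B x hx)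
    obtain ⟨c, hc, hcK⟩ := hfr _ (hZ i).adX
    exact ⟨c, hc, hcK.trans (mul_le_mul_of_nonneg_left (hMx i) hK)⟩
  have hflow : ∀ t ∈ Set.Ioo (-δ) δ, ∀ x ∈ U, ∀ i, fderiv ℝ f (t, x) (0, Z i x) = 0 := by
    intro t ht x hx i
    have hscale : ∀ σ ∈ Set.Icc (0 : ℝ) 1, t * σ ∈ Set.Ioo (-δ) δ := fun σ hσ => by
      rw [Set.mem_Ioo, ← abs_lt] at ht ⊢
      rw [abs_mul, abs_of_nonneg hσ.1]
      exact (mul_le_of_le_one_right (abs_nonneg t) hσ.2).trans_lt ht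
    have hrev : ∀ σ ∈ Set.Icc (0 : ℝ) 1, (t * (1 - σ), x) ∈ Set.Ioo (-δ) δ ×ˢ U := fun σ hσ =>
      ⟨hscale _ ⟨by linarith [hσ.2], by linarith [hσ.1]⟩, hx⟩
    have hγ : ∀ σ ∈ Set.Icc (0 : ℝ) 1, HasDerivAt (fun σ => φ (t * (1 - σ), x))
        (-t • X (φ (t * (1 - σ), x))) σ := fun σ hσ => by
      obtain ⟨hz, hz'⟩ := h₁ _ (hrev σ hσ)
      have hcurve : HasDerivAt (fun σ : ℝ => (t * (1 - σ), x))
          (-t • ((1 : ℝ), (0 : Fin k → ℝ))) σ := by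
        have := (((hasDerivAt_id σ).const_sub 1).const_mul t).prodMk (hasDerivAt_const σ x)
        simpa using this
      have h := ((hφs _ (hΩ₀ _ hz)).differentiableAt (by simp)).hasFDerivAt.comp_hasDerivAt σ hcurve
      rwa [map_smul, hφt _ (hΩ₀ _ hz), (hBp _ (hU₀B _ hz')).2.1] at h
    have h := transport_annihilated isOpen_Ioo hU₀ hfs
      (fun x hx => (hXat x (hBp x (hU₀B x hx)).1).differentiableAt (by simp))
      (fun i x hx => (hLat _ (hZ i) x (hBp x (hU₀B x hx)).1).differentiableAt (by simp))
      htrans hstart hbracket (fun σ hσ => (h₁ (t * σ, x) ⟨hscale σ hσ, hx⟩).1.1)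
      (fun σ hσ => (h₁ _ (hrev σ hσ)).2) hγ i
    have hx₀ : φ (t * (1 - 1), x) = x := by
      rw [sub_self, mul_zero]
      exact hφ0 x (hΩ₀ _ (h₁ (0, x) ⟨⟨by linarith, hδ⟩, hx⟩).1)
    rwa [hx₀] at h
  have hUU₀ : ∀ x ∈ U, x ∈ U₀ := fun x hx => (h₁ (0, x) ⟨⟨by linarith, hδ⟩, hx⟩).1.2
  refine ⟨U, hU.mem_nhds hpU, fun x hx => (hBp x (hU₀B x (hUU₀ x hx))).1, δ, hδ, f,
    fun z hz => (hfs z (h₁ z hz).1).contDiffWithinAt, fun x hx => hf0 x (hUU₀ x hx),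
    fun t ht x hx => ?_, fun q t ht x hx => ?_⟩
  · have hz := (h₁ (t, x) ⟨ht, hx⟩).1
    rw [hpartial t x hz, ← htrans _ hz]
    have hd := ((hfs _ hz).differentiableAt (by simp)).hasFDerivAt
    exact (hd.comp_hasDerivAt t ((hasDerivAt_id t).prodMk (hasDerivAt_const t x))).deriv
  · have hz := (h₁ (t, x) ⟨ht, hx⟩).1
    obtain ⟨c, hc, -⟩ := (hBp x (hU₀B x hz.2)).2.2.1 (Y q) (genLie.base q)
    have hsum : ((0 : ℝ), Y q x) = ∑ j, c j • ((0 : ℝ), Z j x) := by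
      rw [hc]
      ext1 <;> simp [Prod.fst_sum, Prod.snd_sum]
    rw [hpartial t x hz, hsum, map_sum]
    exact Finset.sum_eq_zero fun j _ => by rw [map_smul, hflow t ht x hx j, smul_zero]
end

section
/- (Theorem 7(B)) Let X, Y_1,…,Y_ν be C^∞ vector fields on ℝ^k, with X admitting a global flow Φ. Let V be the smallest C^∞(ℝ^k)-submodule of the module of C^∞ vector fields that contains Y_1,…,Y_ν and is invariant under Z ↦ [X, Z], and suppose V is finitely generated over C^∞(ℝ^k). Let g be a C^∞ function with Z g = 0 for every Z ∈ V. Then f(t,x) := g(Φ(t,x)) satisfies ∂f/∂t(t,x) = d_x f(t,·)(x)(X(x)), f(0,·) = g, and Z f(t,·) = 0 for every Z ∈ V and every t; in particular Y_p f(t,·) = 0 for p = 1,…,ν. -/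
open scoped BigOperators

/-- The smallest `C^∞(ℝ^k)`-module of vector fields containing `Y_1, …, Y_ν` and
invariant under `Z ↦ [X, Z]`. -/
inductive genMod {k ν : ℕ} (X : VF k) (Y : Fin ν → VF k) : VF k → Prop
  | base (p : Fin ν) : genMod X Y (Y p)
  | add {Z W : VF k} : genMod X Y Z → genMod X Y W → genMod X Y (fun x => Z x + W x)
  | smul (h : (Fin k → ℝ) → ℝ) (hh : ContDiff ℝ (⊤ : ℕ∞) h) {Z : VF k} :
      genMod X Y Z → genMod X Y (fun x => h x • Z x)
  | adX {Z : VF k} : genMod X Y Z → genMod X Y (lieB X Z)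

/-- A solution of a linear ODE with continuous coefficients that vanishes at one time vanishes
identically. -/
theorem eq_zero_of_linear_ode {E : Type*} [NormedAddCommGroup E] [NormedSpace ℝ E]
    {A : ℝ → E →L[ℝ] E} (hA : Continuous A) {u : ℝ → E}
    (hu : ∀ t, HasDerivAt u (A t (u t)) t) {t₀ : ℝ} (h0 : u t₀ = 0) (t : ℝ) : u t = 0 := by
  obtain ⟨a, b, ht, ht₀⟩ : ∃ a b, t ∈ Set.Ioo a b ∧ t₀ ∈ Set.Ioo a b := by
    use min t t₀ - 1, max t t₀ + 1
    grind
  obtain ⟨K, hK⟩ := (isCompact_Icc (a := a) (b := b)).exists_bound_of_continuousOn hA.continuousOn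
  refine ODE_solution_unique_of_mem_Ioo (v := fun t => A t) (K := K.toNNReal)
    (s := fun _ => Set.univ) (g := fun _ => 0) (fun s hs => ?_) ht₀ (fun s _ => ⟨hu s, trivial⟩)
    (fun s _ => ⟨by simpa using hasDerivAt_const s (0 : E), trivial⟩) h0 ht
  refine ((A s).lipschitz.weaken ?_).lipschitzOnWith
  exact NNReal.le_toNNReal_of_coe_le (hK s (Set.Ioo_subset_Icc_self hs))

section Smooth

variable {E F : Type*} [NormedAddCommGroup E] [NormedSpace ℝ E]
  [NormedAddCommGroup F] [NormedSpace ℝ F]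

theorem contDiff_fderiv_of_contDiff_top {f : E → F} (hf : ContDiff ℝ (⊤ : ℕ∞) f) :
    ContDiff ℝ (⊤ : ℕ∞) (fderiv ℝ f) :=
  hf.fderiv_right (by norm_num)

theorem fderiv_fderiv_comm {f : E → F} (hf : ContDiff ℝ (⊤ : ℕ∞) f) (x v w : E) :
    fderiv ℝ (fderiv ℝ f) x v w = fderiv ℝ (fderiv ℝ f) x w v :=
  hf.contDiffAt.isSymmSndFDerivAt (by
    rw [minSmoothness_of_isRCLikeNormedField]
    exact WithTop.coe_le_coe.2 (le_top : (2 : ℕ∞) ≤ ⊤)) v w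

/-- The derivative of `f` along a curve, applied to a constant vector. -/
theorem hasDerivAt_fderiv_comp {f : E → F} (hf : ContDiff ℝ (⊤ : ℕ∞) f) {c : ℝ → E} {c' : E}
    {t : ℝ} (hc : HasDerivAt c c' t) :
    HasDerivAt (fun s => fderiv ℝ f (c s)) (fderiv ℝ (fderiv ℝ f) (c t) c') t :=
  (((contDiff_fderiv_of_contDiff_top hf).differentiable (by simp)) (c t)).hasFDerivAt.comp_hasDerivAt
    t hc

/-- Partial derivatives in the second variable. -/
theorem fderiv_slice {f : ℝ × E → F} (hf : ContDiff ℝ (⊤ : ℕ∞) f) (t : ℝ) (x v : E) :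
    fderiv ℝ (fun y => f (t, y)) x v = fderiv ℝ f (t, x) (0, v) := by
  have h := ((hf.differentiable (by simp)) (t, x)).hasFDerivAt.comp x
    (hasFDerivAt_prodMk_right (𝕜 := ℝ) t x)
  rw [show (fun y => f (t, y)) = f ∘ fun y => (t, y) from rfl, h.fderiv]
  simp

/-- Differentiating a transport identity `∂ₜ f = X f` in space. -/
theorem fderiv_fderiv_of_transport {f : ℝ × E → F} (hf : ContDiff ℝ (⊤ : ℕ∞) f) {X : E → E}
    (hX : ContDiff ℝ (⊤ : ℕ∞) X) (h : ∀ p, fderiv ℝ f p (-1, X p.2) = 0) (p : ℝ × E) (v : E) :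
    fderiv ℝ (fderiv ℝ f) p (-1, X p.2) (0, v) = -fderiv ℝ f p (0, fderiv ℝ X p.2 v) := by
  have h1 := ((contDiff_fderiv_of_contDiff_top hf).differentiable (by simp) p).hasFDerivAt
  have h2 : HasFDerivAt (fun p : ℝ × E => ((-1 : ℝ), X p.2)) _ p :=
    (hasFDerivAt_const (-1 : ℝ) p).prodMk
      (((hX.differentiable (by simp)) p.2).hasFDerivAt.comp p hasFDerivAt_snd)
  have h3 := (h1.clm_apply h2).unique (by simpa only [h] using hasFDerivAt_const (0 : F) p)
  have h4 := DFunLike.congr_fun h3 (0, v)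
  rw [fderiv_fderiv_comm hf]
  simp at h4
  rw [eq_neg_iff_add_eq_zero, add_comm]
  exact h4

/-- A global smooth flow preserves its vector field. -/
theorem fderiv_flow_apply {X : E → E} (hX : ContDiff ℝ (⊤ : ℕ∞) X) {Φ : ℝ × E → E}
    (hΦ : ContDiff ℝ (⊤ : ℕ∞) Φ) (hΦ0 : ∀ x, Φ (0, x) = x)
    (hflow : ∀ p, fderiv ℝ Φ p (1, 0) = X (Φ p)) (t : ℝ) (x : E) :
    fderiv ℝ Φ (t, x) (-1, X x) = 0 := by
  refine eq_zero_of_linear_ode (A := fun s => fderiv ℝ X (Φ (s, x)))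
    (u := fun s => fderiv ℝ Φ (s, x) (-1, X x)) (t₀ := 0) ?_ (fun s => ?_) ?_ t
  · exact (contDiff_fderiv_of_contDiff_top hX).continuous.comp
      (hΦ.continuous.comp (by fun_prop))
  · have hc : HasDerivAt (fun s : ℝ => (s, x)) ((1 : ℝ), (0 : E)) s :=
      (hasDerivAt_id s).prodMk (hasDerivAt_const s x)
    have h1 := (hasDerivAt_fderiv_comp hΦ hc).clm_apply
      (hasDerivAt_const s ((-1 : ℝ), X x))
    have h2 := ((contDiff_fderiv_of_contDiff_top hΦ).differentiable (by simp)
      (s, x)).hasFDerivAt.clm_apply (hasFDerivAt_const ((1 : ℝ), (0 : E)) (s, x))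
    have h3 := ((hX.differentiable (by simp)) (Φ (s, x))).hasFDerivAt.comp (s, x)
      ((hΦ.differentiable (by simp)) (s, x)).hasFDerivAt
    have h4 := DFunLike.congr_fun (h2.unique (by simpa only [hflow, Function.comp_def] using h3)) (-1, X x)
    refine h1.congr_deriv ?_
    rw [fderiv_fderiv_comm hΦ]
    simpa using h4
  · have h1 := fderiv_slice hΦ 0 x (X x)
    have h2 := hflow (0, x)
    simp only [hΦ0, fderiv_fun_id, ContinuousLinearMap.id_apply] at h1 h2
    rw [show ((-1 : ℝ), X x) = (0, X x) - (1, 0) by simp, map_sub, ← h1, h2, sub_self]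

end Smooth

theorem genMod.contDiff {k ν : ℕ} {X : VF k} (hX : ContDiff ℝ (⊤ : ℕ∞) X) {Y : Fin ν → VF k}
    (hY : ∀ q, ContDiff ℝ (⊤ : ℕ∞) (Y q)) {Z : VF k} (hZ : genMod X Y Z) :
    ContDiff ℝ (⊤ : ℕ∞) Z := by
  induction hZ with
  | base p => exact hY p
  | add _ _ hZ hW => exact hZ.add hW
  | smul h hh _ hZ => exact hh.smul hZ
  | adX _ hZ =>
    exact ((contDiff_fderiv_of_contDiff_top hZ).clm_apply hX).sub
      ((contDiff_fderiv_of_contDiff_top hX).clm_apply hZ)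

/-- Along the flow of `X`, the derivative of a solution `f` of `∂ₜ f = X f` in the direction `Z`
evolves by the Lie bracket. -/
theorem hasDerivAt_transport_apply {k : ℕ} {X Z : VF k} (hX : ContDiff ℝ (⊤ : ℕ∞) X)
    (hZ : ContDiff ℝ (⊤ : ℕ∞) Z) {f : ℝ × (Fin k → ℝ) → ℝ} (hf : ContDiff ℝ (⊤ : ℕ∞) f)
    (h : ∀ p, fderiv ℝ f p (-1, X p.2) = 0) {γ : ℝ → Fin k → ℝ} (t : ℝ) {s : ℝ}
    (hγ : HasDerivAt γ (X (γ s)) s) :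
    HasDerivAt (fun s => fderiv ℝ f (t - s, γ s) (0, Z (γ s)))
      (fderiv ℝ f (t - s, γ s) (0, lieB X Z (γ s))) s := by
  have hc : HasDerivAt (fun s => (t - s, γ s)) (-1, X (γ s)) s :=
    ((hasDerivAt_id s).const_sub t).prodMk hγ
  have hZγ : HasDerivAt (fun s => ((0 : ℝ), Z (γ s))) (0, fderiv ℝ Z (γ s) (X (γ s))) s :=
    (hasDerivAt_const s (0 : ℝ)).prodMk
      (((hZ.differentiable (by simp)) (γ s)).hasFDerivAt.comp_hasDerivAt s hγ)
  refine ((hasDerivAt_fderiv_comp hf hc).clm_apply hZγ).congr_deriv ?_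
  have h1 := fderiv_fderiv_of_transport hf hX h (t - s, γ s) (Z (γ s))
  dsimp only at h1
  rw [h1, neg_add_eq_sub, ← map_sub]
  simp [lieB]

/-- Theorem 7(B): if the `C^∞`-module `V` generated by `Y_1,…,Y_ν` and
invariant under `ad_X` is finitely generated and `g` is annihilated by `V`, then
`f(t,x) = g(Φ(t,x))` solves the transport equation with initial datum `g` and remains
annihilated by every `Z ∈ V`; in particular by the `Y_p`. -/
theorem theorem7B {k ν : ℕ}
    (X : VF k) (hX : ContDiff ℝ (⊤ : ℕ∞) X)
    (Y : Fin ν → VF k) (hY : ∀ q, ContDiff ℝ (⊤ : ℕ∞) (Y q))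
    (Φ : ℝ → (Fin k → ℝ) → (Fin k → ℝ))
    (hΦsmooth : ContDiff ℝ (⊤ : ℕ∞) (fun q : ℝ × (Fin k → ℝ) => Φ q.1 q.2))
    (hΦ0 : ∀ x, Φ 0 x = x)
    (hΦflow : ∀ (t : ℝ) (x : Fin k → ℝ), HasDerivAt (fun s => Φ s x) (X (Φ t x)) t)
    (hfg : ∃ (N : ℕ) (C : Fin N → VF k), (∀ j, genMod X Y (C j)) ∧
      ∀ Z : VF k, genMod X Y Z → ∃ c : Fin N → (Fin k → ℝ) → ℝ,
        (∀ j, ContDiff ℝ (⊤ : ℕ∞) (c j)) ∧ Z = fun x => ∑ j, c j x • C j x)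
    (g : (Fin k → ℝ) → ℝ) (hg : ContDiff ℝ (⊤ : ℕ∞) g)
    (hgann : ∀ Z : VF k, genMod X Y Z → ∀ x, fderiv ℝ g x (Z x) = 0) :
    (∀ (t : ℝ) (x : Fin k → ℝ),
      deriv (fun s => g (Φ s x)) t = fderiv ℝ (fun y => g (Φ t y)) x (X x)) ∧
    (∀ x, g (Φ 0 x) = g x) ∧
    (∀ Z : VF k, genMod X Y Z → ∀ (t : ℝ) (x : Fin k → ℝ),
      fderiv ℝ (fun y => g (Φ t y)) x (Z x) = 0) ∧
    (∀ (q : Fin ν) (t : ℝ) (x : Fin k → ℝ),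
      fderiv ℝ (fun y => g (Φ t y)) x (Y q x) = 0) := by
  have hΦd (p : ℝ × (Fin k → ℝ)) :
      fderiv ℝ (fun q : ℝ × (Fin k → ℝ) => Φ q.1 q.2) p (1, 0) = X (Φ p.1 p.2) := by
    have hc : HasDerivAt (fun s : ℝ => (s, p.2)) ((1 : ℝ), (0 : Fin k → ℝ)) p.1 :=
      (hasDerivAt_id p.1).prodMk (hasDerivAt_const p.1 p.2)
    have h := ((hΦsmooth.differentiable (by simp)) p).hasFDerivAt.comp_hasDerivAt p.1 hc
    exact h.unique (hΦflow p.1 p.2)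
  set f : ℝ × (Fin k → ℝ) → ℝ := fun q => g (Φ q.1 q.2)
  have hf : ContDiff ℝ (⊤ : ℕ∞) f := hg.comp hΦsmooth
  have hfX (p : ℝ × (Fin k → ℝ)) : fderiv ℝ f p (-1, X p.2) = 0 := by
    have h := ((hg.differentiable (by simp)) (Φ p.1 p.2)).hasFDerivAt.comp p
      ((hΦsmooth.differentiable (by simp)) p).hasFDerivAt
    rw [show f = g ∘ fun q : ℝ × (Fin k → ℝ) => Φ q.1 q.2 from rfl, h.fderiv,
      ContinuousLinearMap.comp_apply, fderiv_flow_apply hX hΦsmooth hΦ0 hΦd p.1 p.2, map_zero]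
  have hslice (t : ℝ) (x v : Fin k → ℝ) :
      fderiv ℝ (fun y => g (Φ t y)) x v = fderiv ℝ f (t, x) (0, v) := fderiv_slice hf t x v
  have hann (Z : VF k) (hZ : genMod X Y Z) (t : ℝ) (x : Fin k → ℝ) :
      fderiv ℝ (fun y => g (Φ t y)) x (Z x) = 0 := by
    obtain ⟨N, C, hC, hgen⟩ := hfg
    choose c hc hcC using fun j => hgen _ (hC j).adX
    let φ : ℝ → Fin N → ℝ := fun s j => fderiv ℝ f (t - s, Φ s x) (0, C j (Φ s x))
    let A : ℝ → (Fin N → ℝ) →L[ℝ] (Fin N → ℝ) := fun s => ∑ j, ∑ l, c j l (Φ s x) •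
      (ContinuousLinearMap.proj (R := ℝ) (φ := fun _ : Fin N => ℝ) l).smulRight
        (Pi.single j (1 : ℝ) : Fin N → ℝ)
    have hA : Continuous A := by
      refine continuous_finsetSum _ fun j _ => continuous_finsetSum _ fun l _ => ?_
      have hcont : Continuous fun s => c j l (Φ s x) := (hc j l).continuous.comp (hΦsmooth.continuous.comp (by fun_prop : Continuous
        fun s : ℝ => (s, x)))
      exact hcont.smul continuous_const
    have hφ (s : ℝ) : HasDerivAt φ (A s (φ s)) s := by
      rw [hasDerivAt_pi]
      intro j
      refine (hasDerivAt_transport_apply hX ((hC j).contDiff hX hY) hf hfX t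
        (hΦflow s x)).congr_deriv ?_
      have hA_apply : A s (φ s) j = ∑ l, c j l (Φ s x) * φ s l := by
        simp [A, Pi.single_apply]
      rw [hA_apply, hcC j]
      simp only [← hslice, map_sum, map_smul, smul_eq_mul, φ]
    have hφt : φ t = 0 := by
      ext j
      have h := hslice 0 (Φ t x) (C j (Φ t x))
      simp only [hΦ0] at h
      simp only [φ, sub_self, Pi.zero_apply]
      rw [← h]
      exact hgann _ (hC j) _
    have hφ0 (j : Fin N) : fderiv ℝ f (t, x) (0, C j x) = 0 := by
      simpa [φ, hΦ0] using congrFun (eq_zero_of_linear_ode hA hφ hφt 0) j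
    obtain ⟨d, -, rfl⟩ := hgen Z hZ
    simp only [map_sum, map_smul]
    simp only [hslice, hφ0, smul_zero, Finset.sum_const_zero]
  refine ⟨fun t x => ?_, fun x => by rw [hΦ0], hann, fun q => hann _ (.base q)⟩
  have hc : HasDerivAt (fun s : ℝ => (s, x)) ((1 : ℝ), (0 : Fin k → ℝ)) t :=
    (hasDerivAt_id t).prodMk (hasDerivAt_const t x)
  have h := ((hf.differentiable (by simp)) (t, x)).hasFDerivAt.comp_hasDerivAt t hc
  rw [hslice, show (fun s => g (Φ s x)) = f ∘ fun s => (s, x) from rfl, h.deriv,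
    ← sub_eq_zero, ← map_sub, ← neg_eq_zero, ← map_neg]
  simpa using hfX (t, x)
end

section
/- Let U ⊆ ℝ^d be open, x₀ ∈ U, and let M, A : U → M₂(ℝ) be C^∞ matrix-valued functions such that M(x)² = 0 and A(x) M(x) = 0 for all x ∈ U, and M(x₀) ≠ 0. Then there exist a neighborhood V ⊆ U of x₀ and a C^∞ map B : V → M₂(ℝ) with A(x) = B(x) M(x) for all x ∈ V. -/
open Matrix in
/-- A square-zero `2 × 2` matrix `M` over a reduced commutative ring satisfies
`M * Mᵀ + Mᵀ * M = tr (Mᵀ * M) • 1`. -/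
theorem Matrix.mul_transpose_add_transpose_mul_of_mul_self_eq_zero {R : Type*} [CommRing R]
    [IsReduced R] {M : Matrix (Fin 2) (Fin 2) R} (h : M * M = 0) :
    M * Mᵀ + Mᵀ * M = (Mᵀ * M).trace • (1 : Matrix (Fin 2) (Fin 2) R) := by
  have htr : M.trace = 0 :=
    (Matrix.isNilpotent_trace_of_isNilpotent ⟨2, by rw [pow_two, h]⟩).eq_zero
  have h11 : M 1 1 = -M 0 0 := by
    rw [Matrix.trace_fin_two] at htr
    linear_combination htr
  ext i j
  fin_cases i <;> fin_cases j <;>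
    simp [Matrix.mul_apply, Fin.sum_univ_two, Matrix.trace_fin_two, h11] <;> ring


/-- smooth local version of the factorization through a nilpotent
matrix: if `M(x)² = 0`, `A(x) M(x) = 0` on `U` and `M(x₀) ≠ 0`, then `A = B M` near
`x₀` for some `C^∞` matrix-valued `B`. -/
theorem factor_through_nilpotent_smooth {d : ℕ}
    (U : Set (Fin d → ℝ)) (hU : IsOpen U) (x₀ : Fin d → ℝ) (hx₀ : x₀ ∈ U)
    (M A : (Fin d → ℝ) → Matrix (Fin 2) (Fin 2) ℝ)
    (hMsmooth : ∀ i j : Fin 2, ContDiffOn ℝ (⊤ : ℕ∞) (fun x => M x i j) U)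
    (hAsmooth : ∀ i j : Fin 2, ContDiffOn ℝ (⊤ : ℕ∞) (fun x => A x i j) U)
    (hM2 : ∀ x ∈ U, M x * M x = 0)
    (hAM : ∀ x ∈ U, A x * M x = 0)
    (hM0 : M x₀ ≠ 0) :
    ∃ V : Set (Fin d → ℝ), IsOpen V ∧ x₀ ∈ V ∧ V ⊆ U ∧
      ∃ B : (Fin d → ℝ) → Matrix (Fin 2) (Fin 2) ℝ,
        (∀ i j : Fin 2, ContDiffOn ℝ (⊤ : ℕ∞) (fun x => B x i j) V) ∧
        ∀ x ∈ V, A x = B x * M x := by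
  have htrace : ContDiffOn ℝ (⊤ : ℕ∞) (fun x => ((M x).transpose * M x).trace) U := by
    simp only [Matrix.trace, Matrix.diag_apply, Matrix.mul_apply, Matrix.transpose_apply]
    exact ContDiffOn.sum fun i _ => ContDiffOn.sum fun j _ => (hMsmooth j i).mul (hMsmooth j i)
  refine ⟨U ∩ (fun x => ((M x).transpose * M x).trace) ⁻¹' {0}ᶜ,
    htrace.continuousOn.isOpen_inter_preimage hU isOpen_compl_singleton, ⟨hx₀, ?_⟩,
    Set.inter_subset_left,
    fun x => ((M x).transpose * M x).trace⁻¹ • (A x * (M x).transpose), fun i j => ?_, ?_⟩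
  · intro h
    refine hM0 (Matrix.trace_conjTranspose_mul_self_eq_zero_iff.mp ?_)
    rwa [Matrix.conjTranspose_eq_transpose_of_trivial]
  · simp only [Matrix.smul_apply, smul_eq_mul, Matrix.mul_apply (M := A _), Matrix.transpose_apply]
    refine ((htrace.mono Set.inter_subset_left).inv fun x hx => hx.2).mul ?_
    exact ContDiffOn.sum fun k _ =>
      ((hAsmooth i k).mul (hMsmooth j k)).mono Set.inter_subset_left
  · rintro x ⟨hxU, hx⟩
    have key := congrArg (A x * ·)
      (Matrix.mul_transpose_add_transpose_mul_of_mul_self_eq_zero (hM2 x hxU))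
    simp only [mul_add, ← mul_assoc, hAM x hxU, zero_mul, zero_add, mul_smul_comm, mul_one] at key
    rw [smul_mul_assoc, key, inv_smul_smul₀ hx]
end
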